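/- arXiv:0902.3429 — 5 statements merged into one kernel-verified Lean document; each statement's English description precedes it below -/
import Mathlib

section
/- Let 𝓛 be a finite relational language and let Σ be a set of local rules for 𝓛. If every connected 𝓛-structure satisfying all rules of Σ is periodic, equational and commutative, and if the class 𝓔 of connected 𝓛-structures satisfying all rules of Σ is strongly regular, then 𝓔 is a finite union of isomorphism classes. (Theorem 3.11) -/
open FirstOrder FirstOrder.Language Set

namespace Paper

universe u v

variable (L : FirstOrder.Language)

/-- The ball `B_M(u,h)` of a relational structure. -/
def rball {M : Type*} [L.Structure M] (u : M) : ℕ → Set M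
  | 0 => {u}
  | h + 1 => rball u h ∪ {v | ∃ (k : ℕ) (R : L.Relations k) (t : Fin k → M),
      Structure.RelMap R t ∧ (∃ i, t i ∈ rball u h) ∧ ∃ j, t j = v}

/-- A connected structure. -/
def Conn (M : Type*) [L.Structure M] : Prop :=
  ∃ u : M, ∀ v : M, ∃ h : ℕ, v ∈ rball L u h

/-- A locally finite structure. -/
def LocFin (M : Type*) [L.Structure M] : Prop :=
  ∀ u : M, (rball L u 1).Finite

/-- A uniformly locally finite structure. -/
def UnifLocFin (M : Type*) [L.Structure M] : Prop :=
  ∃ r : ℕ, ∀ u : M, (rball L u 1).Finite ∧ (rball L u 1).ncard ≤ r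

/-- A pointed isomorphism `(s,u) ≅ (t,v)` between the substructures induced on subsets. -/
def PointedIso {M : Type*} {N : Type*} [L.Structure M] [L.Structure N]
    (s : Set M) (u : M) (t : Set N) (v : N) : Prop :=
  ∃ f : s ≃ t,
    (∀ (k : ℕ) (R : L.Relations k) (x : Fin k → s),
      Structure.RelMap R (fun i => (x i : M)) ↔ Structure.RelMap R (fun i => (f (x i) : N))) ∧
    ∀ hu : u ∈ s, (f ⟨u, hu⟩ : N) = v

/-- The local isomorphism property for a structure. -/
def RelLIP (M : Type*) [L.Structure M] : Prop :=
  ∀ (u : M) (h : ℕ), ∃ k : ℕ, ∀ v : M, ∃ w ∈ rball L v k,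
    PointedIso L (rball L w h) w (rball L u h) u

/-- `M ⋐ N`. -/
def RelSub (M : Type*) (N : Type*) [L.Structure M] [L.Structure N] : Prop :=
  ∀ (u : M) (h : ℕ),
    (∃ g : {v : M | PointedIso L (rball L v h) v (rball L u h) u} →
        {w : N | PointedIso L (rball L w h) w (rball L u h) u}, Function.Injective g) ∨
    ({v : M | PointedIso L (rball L v h) v (rball L u h) u}.Infinite ∧
      {w : N | PointedIso L (rball L w h) w (rball L u h) u}.Infinite)

/-- Locally isomorphic structures. -/
def RelLocIso (M : Type*) (N : Type*) [L.Structure M] [L.Structure N] : Prop :=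
  RelSub L M N ∧ RelSub L N M

/-- A rigid structure: no nontrivial automorphism. -/
def Rigid (M : Type*) [L.Structure M] : Prop :=
  ∀ f : M ≃[L] M, ∀ x : M, f x = x

/-- A periodic connected structure. -/
def Periodic (M : Type*) [L.Structure M] : Prop :=
  ∃ A : Set M, A.Finite ∧ ∀ x : M, ∃ σ : M ≃[L] M, ∃ a ∈ A, σ a = x

/-- A period: `M` is the disjoint union of the sets `Aσ`, `σ ∈ Aut(M)`. -/
def IsPeriod {M : Type*} [L.Structure M] (A : Set M) : Prop :=
  ∀ x : M, ∃! σ : M ≃[L] M, x ∈ (fun a => σ a) '' A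

/-- `M` is periodic of periodicity rank `r`. -/
def HasRank (M : Type*) [L.Structure M] (r : ℕ) : Prop :=
  ∃ A : Set M, IsPeriod L A ∧ A.Finite ∧ A.ncard = r

/-- An equational structure. -/
def Equational (M : Type*) [L.Structure M] : Prop :=
  ∀ (k : ℕ) (R : L.Relations k) (x y : Fin k → M),
    Structure.RelMap R x → Structure.RelMap R y → (∃ i, x i = y i) → ∀ j, x j = y j

/-- `x(R,i,j) = y`. -/
def rstep {M : Type*} [L.Structure M] {k : ℕ} (R : L.Relations k) (i j : Fin k)
    (x y : M) : Prop :=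
  i ≠ j ∧ ∃ t : Fin k → M, Structure.RelMap R t ∧ t i = x ∧ t j = y

/-- Words over the alphabet of triples `(R,i,j)`. -/
def Word (L : FirstOrder.Language) : Type _ :=
  List ((k : ℕ) × (L.Relations k × Fin k × Fin k))

/-- `xw = y` for a word `w`. -/
def wrel {M : Type*} [L.Structure M] : Word L → M → M → Prop
  | [], x, y => x = y
  | ⟨_, R, i, j⟩ :: w, x, y => ∃ z, rstep L R i j x z ∧ wrel w z y

/-- A partial isomorphism from `B_M(x,r)` to `N`. -/
def PartialIso {M : Type*} {N : Type*} [L.Structure M] [L.Structure N]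
    (x : M) (r : ℕ) (ρ : rball L x r → N) : Prop :=
  Function.Injective ρ ∧
    ∀ (k : ℕ) (R : L.Relations k) (i j : Fin k), i ≠ j →
      ∀ y z : rball L x r,
        ((∃ y' : M, rstep L R i j (y : M) y') ↔ (∃ y' : N, rstep L R i j (ρ y) y')) ∧
        (rstep L R i j (y : M) (z : M) ↔ rstep L R i j (ρ y) (ρ z))

/-- A commutative equational structure. -/
def Comm (M : Type*) [L.Structure M] : Prop :=
  ∀ (x : M) (r : ℕ), 1 ≤ r → ∀ ρ : rball L x r → M, PartialIso L x r ρ →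
    ∀ σ : M ≃[L] M, ∀ y : rball L x r, ∀ h : σ (y : M) ∈ rball L x r,
      σ (ρ y) = ρ ⟨σ (y : M), h⟩

/-- The strong regularity condition between two structures. -/
def SRcond (M : Type*) (N : Type*) [L.Structure M] [L.Structure N] : Prop :=
  ∀ (w : Word L) (x : M) (y : N),
    (∃ x' : M, wrel L w x x') → (∃ y' : N, wrel L w y y') →
      (wrel L w x x ↔ wrel L w y y)

/-- A weakly connected subset. -/
def WeaklyConnected {M : Type*} [L.Structure M] (A : Set M) : Prop :=
  ∀ B : Set M, B ⊆ A → B.Nonempty → B ≠ A →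
    ∃ (k : ℕ) (R : L.Relations k) (t : Fin k → M), 2 ≤ k ∧ Structure.RelMap R t ∧
      (∃ i, t i ∈ B) ∧ ∃ j, t j ∈ A \ B

/-- A local rule for a relational language `L`. -/
structure RelRule (L : FirstOrder.Language) where
  r : ℕ
  hr : 1 ≤ r
  m : ℕ
  carrier : Fin m → Type u
  struc : ∀ i, L.Structure (carrier i)
  pt : ∀ i, carrier i
  fin : ∀ i, Finite (carrier i)
  ballEq : ∀ i, @rball L (carrier i) (struc i) (pt i) r = Set.univ

/-- A structure satisfies a local rule. -/
def SatRule (M : Type*) [L.Structure M] (Γ : RelRule.{u} L) : Prop :=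
  ∀ x : M, ∃ i, @PointedIso L M (Γ.carrier i) _ (Γ.struc i)
    (rball L x Γ.r) x (@rball L (Γ.carrier i) (Γ.struc i) (Γ.pt i) Γ.r) (Γ.pt i)

section Words

variable {L} {M : Type*} {N : Type*} {N' : Type*}
variable [L.Structure M] [L.Structure N] [L.Structure N']

/-- The alphabet of triples `(R,i,j)`. -/
abbrev Letter (L : FirstOrder.Language) := (k : ℕ) × (L.Relations k × Fin k × Fin k)

theorem rstep_symm {k : ℕ} {R : L.Relations k} {i j : Fin k} {x y : M}
    (h : rstep L R i j x y) : rstep L R j i y x := by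
  obtain ⟨hij, t, ht, hx, hy⟩ := h
  exact ⟨hij.symm, t, ht, hy, hx⟩

theorem rstep_unique (hM : Equational L M) {k : ℕ} {R : L.Relations k} {i j : Fin k}
    {x y y' : M} (h : rstep L R i j x y) (h' : rstep L R i j x y') : y = y' := by
  obtain ⟨-, t, ht, hx, rfl⟩ := h
  obtain ⟨-, t', ht', hx', rfl⟩ := h'
  exact hM k R t t' ht ht' ⟨i, hx.trans hx'.symm⟩ j

theorem rstep_map (σ : M ≃[L] N) {k : ℕ} {R : L.Relations k} {i j : Fin k} {x y : M}
    (h : rstep L R i j x y) : rstep L R i j (σ x) (σ y) := by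
  obtain ⟨hij, t, ht, rfl, rfl⟩ := h
  exact ⟨hij, σ ∘ t, (σ.map_rel R t).2 ht, rfl, rfl⟩

theorem rstep_of_map (σ : M ≃[L] N) {k : ℕ} {R : L.Relations k} {i j : Fin k} {x : M} {y : N}
    (h : rstep L R i j (σ x) y) : rstep L R i j x (σ.symm y) := by
  simpa using rstep_map σ.symm h

theorem wrel_append {w w' : List (Letter L)} {x y : M} :
    wrel L (w ++ w' : List (Letter L)) x y ↔ ∃ z, wrel L w x z ∧ wrel L w' z y := by
  induction w generalizing x with
  | nil => exact ⟨fun h => ⟨x, rfl, h⟩, fun ⟨_, h, h'⟩ => by cases h; exact h'⟩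
  | cons a w ih =>
    constructor
    · rintro ⟨z, hz, h⟩
      obtain ⟨z', h1, h2⟩ := ih.1 h
      exact ⟨z', ⟨z, hz, h1⟩, h2⟩
    · rintro ⟨z', ⟨z, hz, h1⟩, h2⟩
      exact ⟨z, hz, ih.2 ⟨z', h1, h2⟩⟩

theorem wrel_singleton {k : ℕ} {R : L.Relations k} {i j : Fin k} {x y : M} :
    wrel L ([⟨k, R, i, j⟩] : List (Letter L)) x y ↔ rstep L R i j x y :=
  ⟨fun ⟨_, h, h'⟩ => by cases h'; exact h, fun h => ⟨y, h, rfl⟩⟩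

theorem wrel_unique (hM : Equational L M) {w : List (Letter L)} {x y y' : M}
    (h : wrel L w x y) (h' : wrel L w x y') : y = y' := by
  induction w generalizing x with
  | nil => exact Eq.trans (Eq.symm h) h'
  | cons a w ih =>
    obtain ⟨z, hz, h⟩ := h
    obtain ⟨z', hz', h'⟩ := h'
    obtain rfl := rstep_unique hM hz hz'
    exact ih h h'

theorem wrel_map (σ : M ≃[L] N) {w : List (Letter L)} {x y : M}
    (h : wrel L w x y) : wrel L w (σ x) (σ y) := by
  induction w generalizing x with
  | nil => exact congrArg σ h
  | cons a w ih =>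
    obtain ⟨z, hz, h⟩ := h
    exact ⟨σ z, rstep_map σ hz, ih h⟩

/-- The inverse of a word. -/
def winv : List (Letter L) → List (Letter L)
  | [] => []
  | ⟨k, R, i, j⟩ :: w => winv w ++ [⟨k, R, j, i⟩]

theorem length_winv (w : List (Letter L)) : (winv w).length = w.length := by
  induction w with
  | nil => rfl
  | cons a w ih => simp [winv, ih]

theorem wrel_winv {w : List (Letter L)} {x y : M} (h : wrel L w x y) :
    wrel L (winv w) y x := by
  induction w generalizing x with
  | nil => exact Eq.symm h
  | cons a w ih =>
    obtain ⟨z, hz, h⟩ := h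
    exact wrel_append.2 ⟨z, ih h, wrel_singleton.2 (rstep_symm hz)⟩

theorem wrel_of_winv {w : List (Letter L)} {x y : M} (h : wrel L (winv w) y x) :
    wrel L w x y := by
  induction w generalizing x with
  | nil => exact Eq.symm h
  | cons a w ih =>
    obtain ⟨z, hz, h⟩ := wrel_append.1 h
    exact ⟨z, rstep_symm (wrel_singleton.1 h), ih hz⟩

theorem mem_rball_iff {u v : M} {h : ℕ} :
    v ∈ rball L u h ↔ ∃ w : List (Letter L), w.length ≤ h ∧ wrel L w u v := by
  induction h generalizing v with
  | zero =>
    constructor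
    · intro hv
      exact ⟨[], le_rfl, Eq.symm hv⟩
    · rintro ⟨w, hw, hv⟩
      obtain rfl := List.length_eq_zero_iff.1 (Nat.le_zero.1 hw)
      exact Eq.symm hv
  | succ h ih =>
    constructor
    · rintro (hv | ⟨k, R, t, ht, ⟨i, hi⟩, j, rfl⟩)
      · obtain ⟨w, hw, hv⟩ := ih.1 hv
        exact ⟨w, hw.trans h.le_succ, hv⟩
      · obtain ⟨w, hw, hv⟩ := ih.1 hi
        by_cases hij : i = j
        · exact ⟨w, hw.trans h.le_succ, hij ▸ hv⟩
        · exact ⟨w ++ [⟨k, R, i, j⟩], by simpa using hw,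
            wrel_append.2 ⟨_, hv, wrel_singleton.2 ⟨hij, t, ht, rfl, rfl⟩⟩⟩
    · rintro ⟨w, hw, hv⟩
      obtain rfl | ⟨w', ⟨k, R, i, j⟩, rfl⟩ := List.eq_nil_or_concat' w
      · exact Or.inl (ih.2 ⟨[], Nat.zero_le _, hv⟩)
      · obtain ⟨z, hz, h2⟩ := wrel_append.1 hv
        obtain ⟨-, t, ht, rfl, hy⟩ := wrel_singleton.1 h2
        exact Or.inr ⟨k, R, t, ht, ⟨i, ih.2 ⟨w', by simpa using hw, hz⟩⟩, j, hy⟩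

theorem rball_mono {u : M} {h h' : ℕ} (hh : h ≤ h') : rball L u h ⊆ rball L u h' := by
  intro v hv
  obtain ⟨w, hw, hv⟩ := mem_rball_iff.1 hv
  exact mem_rball_iff.2 ⟨w, hw.trans hh, hv⟩

theorem mem_rball_add {u v x : M} {a b : ℕ} (hv : v ∈ rball L u a) (hx : x ∈ rball L v b) :
    x ∈ rball L u (a + b) := by
  obtain ⟨w, hw, hv⟩ := mem_rball_iff.1 hv
  obtain ⟨w', hw', hx⟩ := mem_rball_iff.1 hx
  exact mem_rball_iff.2 ⟨w ++ w', by simpa using add_le_add hw hw', wrel_append.2 ⟨v, hv, hx⟩⟩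

theorem mem_rball_symm {u v : M} {a : ℕ} (hv : v ∈ rball L u a) : u ∈ rball L v a := by
  obtain ⟨w, hw, hv⟩ := mem_rball_iff.1 hv
  exact mem_rball_iff.2 ⟨winv w, (length_winv w).trans_le hw, wrel_winv hv⟩

theorem mem_rball_map (σ : M ≃[L] N) {u v : M} {a : ℕ} (hv : v ∈ rball L u a) :
    σ v ∈ rball L (σ u) a := by
  obtain ⟨w, hw, hv⟩ := mem_rball_iff.1 hv
  exact mem_rball_iff.2 ⟨w, hw, wrel_map σ hv⟩

theorem rstep_mem_rball {u x y : M} {a k : ℕ} {R : L.Relations k} {i j : Fin k}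
    (hx : x ∈ rball L u a) (h : rstep L R i j x y) : y ∈ rball L u (a + 1) :=
  mem_rball_add hx (mem_rball_iff.2 ⟨[⟨k, R, i, j⟩], le_rfl, wrel_singleton.2 h⟩)

theorem Conn.exists_wrel (hM : Conn L M) (x y : M) : ∃ w : List (Letter L), wrel L w x y := by
  obtain ⟨u, hu⟩ := hM
  obtain ⟨a, hx⟩ := hu x
  obtain ⟨b, hy⟩ := hu y
  obtain ⟨w, -, hw⟩ := mem_rball_iff.1 (mem_rball_add (mem_rball_symm hx) hy)
  exact ⟨w, hw⟩

theorem Periodic.exists_bound (hM : Periodic L M) (hC : Conn L M) :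
    ∃ D : ℕ, ∀ u v : M, ∃ σ : M ≃[L] M, σ v ∈ rball L u D := by
  obtain ⟨A, hA, hcov⟩ := hM
  choose w hw using hC.exists_wrel
  obtain ⟨D, hD⟩ := ((hA.prod hA).image fun p => (w p.1 p.2).length).bddAbove
  refine ⟨D, fun u v => ?_⟩
  obtain ⟨τ, a, ha, rfl⟩ := hcov u
  obtain ⟨τ', a', ha', rfl⟩ := hcov v
  refine ⟨τ.comp τ'.symm, ?_⟩
  rw [FirstOrder.Language.Equiv.comp_apply, FirstOrder.Language.Equiv.symm_apply_apply]
  exact mem_rball_map τ (mem_rball_iff.2 ⟨w a a',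
    hD (Set.mem_image_of_mem (fun p : M × M => (w p.1 p.2).length) (Set.mk_mem_prod ha ha')),
    hw a a'⟩)

variable (L) in
/-- Two points (of possibly different structures) at which the same relations occur at the same
indices, in structures satisfying the same nullary relations. -/
def SameTp (x : M) (y : N) : Prop :=
  (∀ (k : ℕ) (R : L.Relations k) (i : Fin k),
    (∃ t : Fin k → M, Structure.RelMap R t ∧ t i = x) ↔
      ∃ t : Fin k → N, Structure.RelMap R t ∧ t i = y) ∧
  ∀ R : L.Relations 0, Structure.RelMap R (Fin.elim0 : Fin 0 → M) ↔
    Structure.RelMap R (Fin.elim0 : Fin 0 → N)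

theorem SameTp.symm {x : M} {y : N} (h : SameTp L x y) : SameTp L y x :=
  ⟨fun k R i => (h.1 k R i).symm, fun R => (h.2 R).symm⟩

theorem SameTp.trans {x : M} {y : N} {z : N'} (h : SameTp L x y) (h' : SameTp L y z) :
    SameTp L x z :=
  ⟨fun k R i => (h.1 k R i).trans (h'.1 k R i), fun R => (h.2 R).trans (h'.2 R)⟩

theorem sameTp_map (σ : M ≃[L] N) (x : M) : SameTp L x (σ x) := by
  refine ⟨fun k R i => ⟨?_, ?_⟩, fun R => ?_⟩
  · rintro ⟨t, ht, rfl⟩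
    exact ⟨σ ∘ t, (σ.map_rel R t).2 ht, rfl⟩
  · rintro ⟨t, ht, hx⟩
    exact ⟨σ.symm ∘ t, (σ.symm.map_rel R t).2 ht, by simp [hx]⟩
  · rw [← σ.map_rel R, Subsingleton.elim (σ ∘ Fin.elim0) Fin.elim0]

theorem SameTp.exists_rstep {x x' : M} {y : N} (h : SameTp L x y) {k : ℕ} {R : L.Relations k}
    {i j : Fin k} (hx : rstep L R i j x x') : ∃ y', rstep L R i j y y' := by
  obtain ⟨hij, t, ht, hi, -⟩ := hx
  obtain ⟨t', ht', hi'⟩ := (h.1 k R i).1 ⟨t, ht, hi⟩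
  exact ⟨t' j, hij, t', ht', hi', rfl⟩

variable (L) in
/-- The points `x` and `y` see the same types along words of length at most `K`. -/
def LAgree (K : ℕ) (x : M) (y : N) : Prop :=
  ∀ w : List (Letter L), w.length ≤ K → ∀ x' y', wrel L w x x' → wrel L w y y' → SameTp L x' y'

theorem LAgree.symm {K : ℕ} {x : M} {y : N} (h : LAgree L K x y) : LAgree L K y x :=
  fun w hw x' y' hx hy => (h w hw y' x' hy hx).symm

theorem LAgree.exists_wrel {K : ℕ} {x x' : M} {y : N} (h : LAgree L K x y) {w : List (Letter L)}
    (hw : w.length ≤ K + 1) (hx : wrel L w x x') : ∃ y', wrel L w y y' := by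
  induction w using List.reverseRecOn generalizing x' with
  | nil => exact ⟨y, rfl⟩
  | append_singleton w a ih =>
    have hlen : w.length ≤ K := by simpa using hw
    obtain ⟨z, hz, h2⟩ := wrel_append.1 hx
    obtain ⟨z', hz'⟩ := ih (hlen.trans K.le_succ) hz
    obtain ⟨y', hy'⟩ := (h w hlen z z' hz hz').exists_rstep (wrel_singleton.1 h2)
    exact ⟨y', wrel_append.2 ⟨z', hz', wrel_singleton.2 hy'⟩⟩

theorem LAgree.trans {K : ℕ} {x : M} {y : N} {z : N'} (h : LAgree L K x y)
    (h' : LAgree L K y z) : LAgree L K x z := by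
  intro w hw x' z' hx hz
  obtain ⟨y', hy⟩ := h.exists_wrel (hw.trans K.le_succ) hx
  exact (h w hw _ _ hx hy).trans (h' w hw _ _ hy hz)

theorem LAgree.tail {K K' : ℕ} {x x' : M} {y y' : N} (h : LAgree L K x y)
    {w : List (Letter L)} (hK : w.length + K' ≤ K) (hx : wrel L w x x') (hy : wrel L w y y') :
    LAgree L K' x' y' := fun w' hw' x'' y'' hx' hy' =>
  h (w ++ w') (by simpa using (add_le_add_right hw' _).trans hK) _ _
    (wrel_append.2 ⟨x', hx, hx'⟩) (wrel_append.2 ⟨y', hy, hy'⟩)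

theorem LAgree.sameTp {K : ℕ} {x : M} {y : N} (h : LAgree L K x y) : SameTp L x y :=
  h [] (Nat.zero_le _) x y rfl rfl

/-- A relation between points of two structures which preserves types and is closed under
common steps sees agreement along all words. -/
theorem lAgree_of_bisimulation {P : M → N → Prop} (hP : ∀ u v, P u v → SameTp L u v)
    (hstep : ∀ u v, P u v → ∀ (k : ℕ) (R : L.Relations k) (i j : Fin k) (u' : M) (v' : N),
      rstep L R i j u u' → rstep L R i j v v' → P u' v')
    {x : M} {y : N} (h : P x y) (K : ℕ) : LAgree L K x y := by
  intro w hw x' y' hx hy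
  induction w generalizing x y with
  | nil =>
    cases hx
    cases hy
    exact hP _ _ h
  | cons a w ih =>
    obtain ⟨z, hz, hx⟩ := hx
    obtain ⟨z', hz', hy⟩ := hy
    exact ih (hstep _ _ h _ _ _ _ _ _ hz hz') (Nat.le_of_succ_le hw) hx hy

variable (L) in
/-- The points `y` and `y'` are reached from `z` and `z'` by a common word of length at most
`n`. -/
def Linked (n : ℕ) (z : M) (z' : N) (y : M) (y' : N) : Prop :=
  ∃ w : List (Letter L), w.length ≤ n ∧ wrel L w z y ∧ wrel L w z' y'

theorem Linked.symm {n : ℕ} {z y : M} {z' y' : N} (h : Linked L n z z' y y') :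
    Linked L n z' z y' y := by
  obtain ⟨w, hw, h1, h2⟩ := h
  exact ⟨w, hw, h2, h1⟩

theorem Linked.mono {n m : ℕ} (hnm : n ≤ m) {z y : M} {z' y' : N}
    (h : Linked L n z z' y y') : Linked L m z z' y y' := by
  obtain ⟨w, hw, h1, h2⟩ := h
  exact ⟨w, hw.trans hnm, h1, h2⟩

theorem Linked.rstep {n k : ℕ} {z y u : M} {z' y' u' : N} (h : Linked L n z z' y y')
    {R : L.Relations k} {i j : Fin k} (hu : rstep L R i j y u) (hu' : rstep L R i j y' u') :
    Linked L (n + 1) z z' u u' := by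
  obtain ⟨w, hw, h1, h2⟩ := h
  exact ⟨w ++ [⟨k, R, i, j⟩], by simpa using hw, wrel_append.2 ⟨y, h1, wrel_singleton.2 hu⟩,
    wrel_append.2 ⟨y', h2, wrel_singleton.2 hu'⟩⟩

theorem Linked.sameTp {n K : ℕ} {z y : M} {z' y' : N} (h : Linked L n z z' y y')
    (hA : LAgree L K z z') (hn : n ≤ K) : SameTp L y y' := by
  obtain ⟨w, hw, h1, h2⟩ := h
  exact hA w (hw.trans hn) _ _ h1 h2

theorem LAgree.exists_linked {n K : ℕ} {z y : M} {z' : N} (hA : LAgree L K z z')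
    (hn : n ≤ K + 1) (hy : y ∈ rball L z n) : ∃ y', Linked L n z z' y y' := by
  obtain ⟨w, hw, h⟩ := mem_rball_iff.1 hy
  obtain ⟨y', hy'⟩ := hA.exists_wrel (hw.trans hn) h
  exact ⟨y', w, hw, h, hy'⟩

theorem SRcond.symm (h : SRcond L M N) : SRcond L N M :=
  fun w x y hx hy => (h w y x hy hx).symm

theorem Linked.wrel_of_wrel (hSR : SRcond L M N) (hN : Equational L N) {K a b : ℕ}
    {z y u : M} {z' y' u' : N} (hA : LAgree L K z z') (hy : Linked L a z z' y y')
    (hu : Linked L b z z' u u') {w : List (Letter L)} (hK : a + w.length + b ≤ K + 1)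
    (h : wrel L w y u) : wrel L w y' u' := by
  obtain ⟨w1, hw1, hy, hy'⟩ := hy
  obtain ⟨w2, hw2, hu, hu'⟩ := hu
  have hz : wrel L (w1 ++ (w ++ winv w2) : List (Letter L)) z z :=
    wrel_append.2 ⟨y, hy, wrel_append.2 ⟨u, h, wrel_winv hu⟩⟩
  have hz' := hA.exists_wrel (by simp [length_winv]; omega) hz
  obtain ⟨y1, hy1, hz2⟩ := wrel_append.1 ((hSR _ z z' ⟨z, hz⟩ hz').1 hz)
  obtain ⟨u1, hu1, hz3⟩ := wrel_append.1 hz2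
  obtain rfl := wrel_unique hN hy' hy1
  obtain rfl := wrel_unique hN hu' (wrel_of_winv hz3)
  exact hu1

theorem Linked.eq (hSR : SRcond L M N) (hN : Equational L N) {K a b : ℕ}
    {z y : M} {z' y' u' : N} (hA : LAgree L K z z') (hy : Linked L a z z' y y')
    (hu : Linked L b z z' y u') (hK : a + b ≤ K + 1) : y' = u' :=
  Linked.wrel_of_wrel (w := []) hSR hN hA hy hu (by simpa using hK) rfl

theorem Linked.rstep_of_rstep (hSR : SRcond L M N) (hN : Equational L N) {K a b k : ℕ}
    {z y u : M} {z' y' u' : N} (hA : LAgree L K z z') (hy : Linked L a z z' y y')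
    (hu : Linked L b z z' u u') {R : L.Relations k} {i j : Fin k} (hK : a + b ≤ K)
    (h : Paper.rstep L R i j y u) : Paper.rstep L R i j y' u' :=
  wrel_singleton.1 (Linked.wrel_of_wrel hSR hN hA hy hu (by simp; omega) (wrel_singleton.2 h))

theorem relMap_of_linked (hSR : SRcond L M N) (hN : Equational L N) {z : M} {z' : N}
    (hA : ∀ K, LAgree L K z z') {k : ℕ} {R : L.Relations k} {t : Fin k → M} {t' : Fin k → N}
    (htt : ∀ i, ∃ n, Linked L n z z' (t i) (t' i)) (ht : Structure.RelMap R t) :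
    Structure.RelMap R t' := by
  cases k with
  | zero =>
    rw [Subsingleton.elim t Fin.elim0] at ht
    rw [Subsingleton.elim t' Fin.elim0]
    exact ((hA 0).sameTp.2 R).1 ht
  | succ k =>
    choose n hn using htt
    obtain ⟨s, hs, hs0⟩ := (((hn 0).sameTp (hA _) le_rfl).1 _ R 0).1 ⟨t, ht, rfl⟩
    suffices s = t' by rwa [← this]
    funext j
    by_cases hj : 0 = j
    · exact hj ▸ hs0
    · exact rstep_unique hN ⟨hj, s, hs, hs0, rfl⟩
        (Linked.rstep_of_rstep hSR hN (hA _) (hn 0) (hn j) le_rfl ⟨hj, t, ht, rfl, rfl⟩)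

theorem exists_equiv_of_lAgree [L.IsRelational] (hM : Equational L M) (hN : Equational L N)
    (hCM : Conn L M) (hCN : Conn L N) (hSR : SRcond L M N) {x : M} {y : N}
    (hA : ∀ K, LAgree L K x y) : ∃ f : M ≃[L] N, f x = y := by
  have hf : ∀ v : M, ∃ v' n, Linked L n x y v v' := fun v => by
    obtain ⟨w, hw⟩ := hCM.exists_wrel x v
    obtain ⟨v', h⟩ := (hA w.length).exists_linked (Nat.le_succ _) (mem_rball_iff.2 ⟨w, le_rfl, hw⟩)
    exact ⟨v', _, h⟩
  have hg : ∀ v : N, ∃ v' n, Linked L n x y v' v := fun v => by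
    obtain ⟨w, hw⟩ := hCN.exists_wrel y v
    obtain ⟨v', h⟩ := (hA w.length).symm.exists_linked (Nat.le_succ _)
      (mem_rball_iff.2 ⟨w, le_rfl, hw⟩)
    exact ⟨v', _, h.symm⟩
  choose f nf hf using hf
  choose g ng hg using hg
  refine ⟨{ toFun := f
            invFun := g
            left_inv := fun v => ?_
            right_inv := fun v => ?_
            map_fun' := fun F => isEmptyElim F
            map_rel' := fun {k} R t => ⟨fun h => ?_, fun h => ?_⟩ }, ?_⟩
  · exact Linked.eq hSR.symm hM (hA _).symm (hg (f v)).symm (hf v).symm (Nat.le_succ _)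
  · exact Linked.eq hSR hN (hA _) (hf (g v)) (hg v) (Nat.le_succ _)
  · exact relMap_of_linked hSR.symm hM (fun K => (hA K).symm)
      (fun i => ⟨_, (hf (t i)).symm⟩) h
  · exact relMap_of_linked hSR hN hA (fun i => ⟨_, hf (t i)⟩) h
  · exact Linked.eq hSR hN (hA _) (hf x) (b := 0) ⟨[], le_rfl, rfl, rfl⟩ (Nat.le_succ _)

theorem Comm.exists_equiv_of_partialIso [L.IsRelational] (hN : Equational L N) (hC : Conn L N)
    (hcomm : Comm L N) (hSR : SRcond L N N) {D R : ℕ}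
    (hD : ∀ u v : N, ∃ σ : N ≃[L] N, σ v ∈ rball L u D) (hR : D + 1 ≤ R) {z : N}
    {ρ : rball L z R → N} (hρ : PartialIso L z R ρ)
    (hty : ∀ y : rball L z R, SameTp L (y : N) (ρ y))
    (y : rball L z R) : ∃ α : N ≃[L] N, α y = ρ y := by
  let P : N → N → Prop := fun u v => ∃ (σ : N ≃[L] N) (y : rball L z R),
    (y : N) ∈ rball L z D ∧ σ y = u ∧ σ (ρ y) = v
  have hP : ∀ y : rball L z R, P y (ρ y) := fun y => by
    obtain ⟨σ, hσ⟩ := hD z y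
    have hmem : σ y ∈ rball L z R := rball_mono (Nat.le_of_succ_le hR) hσ
    refine ⟨σ.symm, ⟨σ y, hmem⟩, hσ, by simp, ?_⟩
    rw [← hcomm z R (by omega) ρ hρ σ y hmem]
    simp
  refine exists_equiv_of_lAgree hN hN hC hC hSR (lAgree_of_bisimulation (P := P) ?_ ?_ (hP y))
  · rintro _ _ ⟨σ, y, -, rfl, rfl⟩
    exact ((sameTp_map σ _).symm.trans (hty y)).trans (sameTp_map σ _)
  · rintro _ _ ⟨σ, y, hy, rfl, rfl⟩ k S i j u' v' hu hv
    have hu := rstep_of_map σ hu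
    have hv := rstep_of_map σ hv
    have hmem := rball_mono hR (rstep_mem_rball hy hu)
    have hv' : ρ ⟨_, hmem⟩ = σ.symm v' :=
      rstep_unique hN ((hρ.2 k S i j hu.1 y ⟨_, hmem⟩).2.1 hu) hv
    obtain ⟨τ, y', hy', h1, h2⟩ := hP ⟨_, hmem⟩
    refine ⟨σ.comp τ, y', hy', ?_, ?_⟩
    · simp [h1]
    · simp [h2, hv']

/-- Agreement on a sufficiently large ball forces agreement everywhere. -/
theorem exists_forall_lAgree [L.IsRelational] (hM : Equational L M) (hN : Equational L N)
    (hCM : Conn L M) (hCN : Conn L N) (hPM : Periodic L M) (hPN : Periodic L N)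
    (hcomm : Comm L N) (hSR : SRcond L M N) (hSRN : SRcond L N N) :
    ∃ K, ∀ (z : M) (z' : N), LAgree L K z z' → ∀ K', LAgree L K' z z' := by
  obtain ⟨D, hD⟩ := hPM.exists_bound hCM
  obtain ⟨D', hD'⟩ := hPN.exists_bound hCN
  set R := D + D' + 1 with hR
  set n := R + (2 * D + 1) with hn
  refine ⟨2 * n, fun z z' hA => ?_⟩
  have transport : ∀ (σ : M ≃[L] M) (y : M) (y' u' : N), Linked L D z z' y y' →
      Linked L (D + 1) z z' (σ y) u' → ∃ α : N ≃[L] N, α y' = u' := by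
    intro σ y y' u' hy hu
    have hσ : ∀ x ∈ rball L z R, σ x ∈ rball L z n := fun x hx => by
      obtain ⟨w, hw, hwy, -⟩ := hy
      obtain ⟨w', hw', hwu, -⟩ := hu
      have h1 := mem_rball_map σ (mem_rball_symm (mem_rball_iff.2 ⟨w, hw, hwy⟩))
      have h2 := mem_rball_add (mem_rball_iff.2 ⟨w', hw', hwu⟩) h1
      exact rball_mono (by omega) (mem_rball_add h2 (mem_rball_map σ hx))
    have hρ : ∀ x' : rball L z' R, ∃ x'' x, Linked L R z z' x x' ∧
        Linked L n z z' (σ x) x'' := fun x' => by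
      obtain ⟨x, hx⟩ := hA.symm.exists_linked (by omega) x'.2
      have hmem : x ∈ rball L z R := by
        obtain ⟨w, hw, -, h⟩ := hx
        exact mem_rball_iff.2 ⟨w, hw, h⟩
      obtain ⟨x'', hx''⟩ := hA.exists_linked (n := n) (by omega) (hσ x hmem)
      exact ⟨x'', x, hx.symm, hx''⟩
    choose ρ Y hY hρ using hρ
    have hty : ∀ x' : rball L z' R, SameTp L (x' : N) (ρ x') := fun x' =>
      (((hY x').sameTp hA (by omega)).symm.trans (sameTp_map σ _)).trans
        ((hρ x').sameTp hA (by omega))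
    have hpart : PartialIso L z' R ρ := by
      refine ⟨fun a b hab => ?_, fun k S i j _ a b => ⟨⟨?_, ?_⟩, fun h => ?_, fun h => ?_⟩⟩
      · have h1 := hρ b
        rw [← hab] at h1
        have h2 := σ.injective (Linked.eq hSR.symm hM hA.symm (hρ a).symm h1.symm (by omega))
        have h3 := hY b
        rw [← h2] at h3
        exact Subtype.ext (Linked.eq hSR hN hA (hY a) h3 (by omega))
      · rintro ⟨c, hc⟩
        exact (hty a).exists_rstep hc
      · rintro ⟨c, hc⟩
        exact (hty a).symm.exists_rstep hc
      · exact Linked.rstep_of_rstep hSR hN hA (hρ a) (hρ b) (by omega) (rstep_map σ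
          (Linked.rstep_of_rstep hSR.symm hM hA.symm (hY a).symm (hY b).symm (by omega) h))
      · have h1 := rstep_of_map σ (Linked.rstep_of_rstep hSR.symm hM hA.symm (hρ a).symm
          (hρ b).symm (by omega) h)
        rw [FirstOrder.Language.Equiv.symm_apply_apply] at h1
        exact Linked.rstep_of_rstep hSR hN hA (hY a) (hY b) (by omega) h1
    have hy' : y' ∈ rball L z' R := by
      obtain ⟨w, hw, -, h⟩ := hy
      exact mem_rball_iff.2 ⟨w, by omega, h⟩
    obtain ⟨α, hα⟩ := hcomm.exists_equiv_of_partialIso hN hCN hSRN hD' (by omega) hpart hty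
      ⟨y', hy'⟩
    refine ⟨α, hα.trans ?_⟩
    have h1 : Y ⟨y', hy'⟩ = y :=
      Linked.eq hSR.symm hM hA.symm (hY ⟨y', hy'⟩).symm hy.symm (by omega)
    have h2 := hρ ⟨y', hy'⟩
    rw [h1] at h2
    exact Linked.eq hSR hN hA h2 hu (by omega)
  refine lAgree_of_bisimulation (P := fun u v => ∃ (σ : M ≃[L] M) (σ' : N ≃[L] N) (y : M) (y' : N),
    Linked L D z z' y y' ∧ σ y = u ∧ σ' y' = v) ?_ ?_
    ⟨.refl L M, .refl L N, z, z', ⟨[], Nat.zero_le _, rfl, rfl⟩, rfl, rfl⟩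
  · rintro _ _ ⟨σ, σ', y, y', hy, rfl, rfl⟩
    exact ((sameTp_map σ y).symm.trans (hy.sameTp hA (by omega))).trans (sameTp_map σ' y')
  · rintro _ _ ⟨σ, σ', y, y', hy, rfl, rfl⟩ k S i j u v hu hv
    have hlink := hy.rstep (rstep_of_map σ hu) (rstep_of_map σ' hv)
    obtain ⟨τ, hτ⟩ := hD z (σ.symm u)
    obtain ⟨y2', hy2⟩ := hA.exists_linked (by omega) hτ
    obtain ⟨α, hα⟩ := transport τ.symm (τ (σ.symm u)) y2' (σ'.symm v) hy2 (by simpa using hlink)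
    exact ⟨σ.comp τ.symm, σ'.comp α, _, _, hy2, by simp, by simp [hα]⟩

theorem finite_letter [Finite ((k : ℕ) × L.Relations k)] : Finite (Letter L) := by
  let e : Letter L → (a : (k : ℕ) × L.Relations k) × (Fin a.1 × Fin a.1) :=
    fun a => ⟨⟨a.1, a.2.1⟩, a.2.2⟩
  refine Finite.of_injective e ?_
  rintro ⟨k, R, i, j⟩ ⟨k', R', i', j'⟩ h
  simp only [e, Sigma.mk.injEq] at h
  obtain ⟨⟨rfl, h1⟩, h2⟩ := h
  cases h1
  cases h2
  rfl

theorem finite_rball [Finite ((k : ℕ) × L.Relations k)] (hM : Equational L M) (x : M) (h : ℕ) :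
    (rball L x h).Finite := by
  have := finite_letter (L := L)
  refine ((List.finite_length_le (Letter L) h).biUnion fun w _ =>
    Set.Subsingleton.finite (s := {y | wrel L w x y}) fun y hy y' hy' =>
      wrel_unique hM hy hy').subset fun y hy => ?_
  obtain ⟨w, hw, hy⟩ := mem_rball_iff.1 hy
  exact Set.mem_biUnion (show w ∈ {w : List (Letter L) | w.length ≤ h} from hw) hy

theorem PointedIso.trans {s : Set M} {x : M} {t : Set N} {y : N} {r : Set N'} {z : N'}
    (h : PointedIso L s x t y) (h' : PointedIso L t y r z) (hx : x ∈ s) :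
    PointedIso L s x r z := by
  obtain ⟨f, hf, hfx⟩ := h
  obtain ⟨g, hg, hgy⟩ := h'
  refine ⟨f.trans g, fun k R t => (hf k R t).trans (hg k R _), fun hu => ?_⟩
  have hy : y ∈ t := hfx hx ▸ (f ⟨x, hx⟩).2
  have : f ⟨x, hu⟩ = ⟨y, hy⟩ := Subtype.ext (hfx hu)
  rw [Equiv.trans_apply, this]
  exact hgy hy

end Words

section Limits

open Filter

theorem Ultrafilter.eventually_exists {α ι : Type*} [Finite ι] {U : Ultrafilter α}
    {p : ι → α → Prop} (h : ∀ᶠ n in U, ∃ i, p i n) : ∃ i, ∀ᶠ n in U, p i n := by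
  by_contra hc
  have := eventually_all.2 fun i => Ultrafilter.eventually_not.2 (not_exists.1 hc i)
  obtain ⟨n, ⟨i, hi⟩, hn⟩ := (h.and this).exists
  exact hn i hi

theorem Ultrafilter.eventually_iff_of_iff {α : Type*} {U : Ultrafilter α} {a : Prop}
    {p : α → Prop} (h : a ↔ ∀ᶠ n in U, p n) : ∀ᶠ n in U, (a ↔ p n) := by
  by_cases ha : a
  · exact (h.1 ha).mono fun n hn => iff_of_true ha hn
  · exact (Ultrafilter.eventually_not.2 (mt h.2 ha)).mono fun n hn => iff_of_false ha hn

variable {L} {X : ℕ → Type u} [∀ n, L.Structure (X n)]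

variable (L) in
/-- Sequences at bounded distance from `p`, modulo almost everywhere equality. -/
def limSetoid (U : Ultrafilter ℕ) (p : ∀ n, X n) :
    Setoid {f : ∀ n, X n // ∃ h, ∀ᶠ n in U, f n ∈ rball L (p n) h} where
  r f g := ∀ᶠ n in U, f.1 n = g.1 n
  iseqv :=
    { refl := fun _ => .of_forall fun _ => rfl
      symm := fun h => h.mono fun _ h => h.symm
      trans := fun h h' => (h.and h').mono fun _ h => h.1.trans h.2 }

variable (L) in
/-- The limit along `U` of the pointed structures `(X n, p n)`: the connected component of `p`
in their ultraproduct. -/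
def Lim (U : Ultrafilter ℕ) (p : ∀ n, X n) : Type u := Quotient (limSetoid L U p)

variable {U : Ultrafilter ℕ} {p : ∀ n, X n}

/-- A sequence representing a point of the limit. -/
noncomputable def Lim.rep (q : Lim L U p) (n : ℕ) : X n := (Quotient.out q).1 n

noncomputable instance [L.IsRelational] : L.Structure (Lim L U p) where
  funMap F := isEmptyElim F
  RelMap R t := ∀ᶠ n in U, Structure.RelMap R fun i => (t i).rep n

namespace Lim

theorem relMap_iff [L.IsRelational] {k : ℕ} {R : L.Relations k} {t : Fin k → Lim L U p} :
    Structure.RelMap R t ↔ ∀ᶠ n in U, Structure.RelMap R fun i => (t i).rep n := Iff.rfl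

theorem rep_bounded (q : Lim L U p) : ∃ h, ∀ᶠ n in U, q.rep n ∈ rball L (p n) h :=
  (Quotient.out q).2

theorem ext_rep {q q' : Lim L U p} (h : ∀ᶠ n in U, q.rep n = q'.rep n) : q = q' := by
  rw [← Quotient.out_eq q, ← Quotient.out_eq q']
  exact Quotient.sound h

theorem exists_rep {f : ∀ n, X n} {h : ℕ} (hf : ∀ᶠ n in U, f n ∈ rball L (p n) h) :
    ∃ q : Lim L U p, ∀ᶠ n in U, q.rep n = f n :=
  ⟨Quotient.mk (limSetoid L U p) ⟨f, h, hf⟩,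
    Quotient.exact (s := limSetoid L U p) (Quotient.out_eq _)⟩

theorem exists_rep_of_mem_rball (q : Lim L U p) {f : ∀ n, X n} {h : ℕ}
    (hf : ∀ᶠ n in U, f n ∈ rball L (q.rep n) h) :
    ∃ q' : Lim L U p, ∀ᶠ n in U, q'.rep n = f n := by
  obtain ⟨a, ha⟩ := q.rep_bounded
  exact exists_rep ((ha.and hf).mono fun n hn => mem_rball_add hn.1 hn.2)

variable [L.IsRelational]

theorem exists_relMap_iff {k : ℕ} {R : L.Relations k} {i : Fin k} {q : Lim L U p} :
    (∃ t, Structure.RelMap R t ∧ t i = q) ↔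
      ∀ᶠ n in U, ∃ t, Structure.RelMap R t ∧ t i = q.rep n := by
  constructor
  · rintro ⟨t, ht, rfl⟩
    exact (relMap_iff.1 ht).mono fun n hn => ⟨_, hn, rfl⟩
  · intro h
    have hex : ∀ n, ∃ t : Fin k → X n, (∃ t, Structure.RelMap R t ∧ t i = q.rep n) →
        Structure.RelMap R t ∧ t i = q.rep n := fun n => by
      by_cases hn : ∃ t, Structure.RelMap R t ∧ t i = q.rep n
      · exact ⟨hn.choose, fun _ => hn.choose_spec⟩
      · exact ⟨fun _ => q.rep n, fun h => absurd h hn⟩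
    choose t ht using hex
    have ht := h.mono fun n hn => ht n hn
    have hq : ∀ j, ∃ q' : Lim L U p, ∀ᶠ n in U, q'.rep n = t n j := fun j =>
      exists_rep_of_mem_rball q (h := 1) (ht.mono fun n hn => Or.inr
        ⟨k, R, t n, hn.1, ⟨i, hn.2⟩, j, rfl⟩)
    choose s hs using hq
    have hs' := eventually_all.2 hs
    refine ⟨s, relMap_iff.2 ((ht.and hs').mono fun n hn => ?_),
      ext_rep ((ht.and hs').mono fun n hn => (hn.2 i).trans hn.1.2)⟩
    rw [funext hn.2]
    exact hn.1.1

theorem rstep_iff {k : ℕ} {R : L.Relations k} {i j : Fin k} {q q' : Lim L U p} :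
    rstep L R i j q q' ↔ ∀ᶠ n in U, rstep L R i j (q.rep n) (q'.rep n) := by
  constructor
  · rintro ⟨hij, t, ht, rfl, rfl⟩
    exact (relMap_iff.1 ht).mono fun n hn => ⟨hij, _, hn, rfl, rfl⟩
  · intro h
    have hex : ∀ n, ∃ t : Fin k → X n, rstep L R i j (q.rep n) (q'.rep n) →
        Structure.RelMap R t ∧ t i = q.rep n ∧ t j = q'.rep n := fun n => by
      by_cases hn : rstep L R i j (q.rep n) (q'.rep n)
      · exact ⟨hn.2.choose, fun _ => hn.2.choose_spec⟩
      · exact ⟨fun _ => q.rep n, fun h => absurd h hn⟩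
    choose t ht using hex
    have ht := h.mono fun n hn => ht n hn
    have hq : ∀ j, ∃ q' : Lim L U p, ∀ᶠ n in U, q'.rep n = t n j := fun j =>
      exists_rep_of_mem_rball q (h := 1) (ht.mono fun n hn => Or.inr
        ⟨k, R, t n, hn.1, ⟨i, hn.2.1⟩, j, rfl⟩)
    choose s hs using hq
    have hs' := eventually_all.2 hs
    refine ⟨h.exists.choose_spec.1, s, relMap_iff.2 ((ht.and hs').mono fun n hn => ?_),
      ext_rep ((ht.and hs').mono fun n hn => (hn.2 i).trans hn.1.2.1),
      ext_rep ((ht.and hs').mono fun n hn => (hn.2 j).trans hn.1.2.2)⟩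
    rw [funext hn.2]
    exact hn.1.1

theorem wrel_iff {w : List (Letter L)} {q q' : Lim L U p} :
    wrel L w q q' ↔ ∀ᶠ n in U, wrel L w (q.rep n) (q'.rep n) := by
  induction w generalizing q with
  | nil =>
    exact ⟨fun h => .of_forall fun n => congrArg (fun q : Lim L U p => q.rep n) h,
      fun h => ext_rep h⟩
  | cons a w ih =>
    obtain ⟨k, R, i, j⟩ := a
    constructor
    · rintro ⟨z, hz, h⟩
      exact ((rstep_iff.1 hz).and (ih.1 h)).mono fun n hn => ⟨_, hn⟩
    · intro h
      have hex : ∀ n, ∃ z : X n, (∃ z, rstep L R i j (q.rep n) z ∧ wrel L w z (q'.rep n)) →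
          rstep L R i j (q.rep n) z ∧ wrel L w z (q'.rep n) := fun n => by
        by_cases hn : ∃ z, rstep L R i j (q.rep n) z ∧ wrel L w z (q'.rep n)
        · exact ⟨hn.choose, fun _ => hn.choose_spec⟩
        · exact ⟨q.rep n, fun h => absurd h hn⟩
      choose z hz using hex
      have hz := h.mono fun n hn => hz n hn
      obtain ⟨y, hy⟩ := exists_rep_of_mem_rball q (f := z) (h := 1) (hz.mono fun n hn =>
        rstep_mem_rball (a := 0) rfl hn.1)
      refine ⟨y, rstep_iff.2 ((hz.and hy).mono fun n hn => ?_),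
        ih.2 ((hz.and hy).mono fun n hn => ?_)⟩
      · rw [hn.2]
        exact hn.1.1
      · rw [hn.2]
        exact hn.1.2

theorem equational (hX : ∀ n, Equational L (X n)) : Equational L (Lim L U p) := by
  rintro k R x y hx hy ⟨i, hi⟩ j
  refine ext_rep (((relMap_iff.1 hx).and (relMap_iff.1 hy)).mono fun n hn => ?_)
  exact hX n k R _ _ hn.1 hn.2 ⟨i, by rw [hi]⟩ j

variable [Finite ((k : ℕ) × L.Relations k)]

theorem eventually_sameTp (q : Lim L U p) : ∀ᶠ n in U, SameTp L q (q.rep n) := by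
  have h1 : ∀ᶠ n in U, ∀ (a : (k : ℕ) × L.Relations k) (i : Fin a.1),
      (∃ t : Fin a.1 → Lim L U p, Structure.RelMap a.2 t ∧ t i = q) ↔
        ∃ t : Fin a.1 → X n, Structure.RelMap a.2 t ∧ t i = q.rep n :=
    eventually_all.2 fun a => eventually_all.2 fun i =>
      Ultrafilter.eventually_iff_of_iff exists_relMap_iff
  have : Finite (L.Relations 0) := Finite.of_injective
    (fun R => (⟨0, R⟩ : (k : ℕ) × L.Relations k)) sigma_mk_injective
  have h2 : ∀ᶠ n in U, ∀ R : L.Relations 0,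
      Structure.RelMap R (Fin.elim0 : Fin 0 → Lim L U p) ↔
        Structure.RelMap R (Fin.elim0 : Fin 0 → X n) :=
    eventually_all.2 fun R => Ultrafilter.eventually_iff_of_iff <| relMap_iff.trans <| by
      refine eventually_congr (.of_forall fun n => ?_)
      rw [Subsingleton.elim (fun i : Fin 0 => rep (Fin.elim0 i : Lim L U p) n) Fin.elim0]
  exact (h1.and h2).mono fun n hn => ⟨fun k R i => hn.1 ⟨k, R⟩ i, hn.2⟩

theorem eventually_lAgree (hX : ∀ n, Equational L (X n)) (q : Lim L U p) (K : ℕ) :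
    ∀ᶠ n in U, LAgree L K q (q.rep n) := by
  have := finite_letter (L := L)
  refine (eventually_all_finite (List.finite_length_le (Letter L) K)).2 fun w _ => ?_
  by_cases hw : ∃ x, wrel L w q x
  · obtain ⟨x, hx⟩ := hw
    refine ((wrel_iff.1 hx).and (eventually_sameTp x)).mono fun n hn x' y' hx' hy' => ?_
    obtain rfl := wrel_unique (equational hX) hx hx'
    obtain rfl := wrel_unique (hX n) hn.1 hy'
    exact hn.2
  · exact .of_forall fun n x' y' hx' _ => absurd ⟨x', hx'⟩ hw

theorem mem_rball_iff {q q' : Lim L U p} {h : ℕ} :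
    q' ∈ rball L q h ↔ ∀ᶠ n in U, q'.rep n ∈ rball L (q.rep n) h := by
  have := finite_letter (L := L)
  have := (List.finite_length_le (Letter L) h).to_subtype
  constructor
  · intro hq
    obtain ⟨w, hw, hq⟩ := Paper.mem_rball_iff.1 hq
    exact (wrel_iff.1 hq).mono fun n hn => Paper.mem_rball_iff.2 ⟨w, hw, hn⟩
  · intro hq
    obtain ⟨⟨w, hw⟩, hq⟩ := Ultrafilter.eventually_exists
      (p := fun (w : {w : List (Letter L) | w.length ≤ h}) n => wrel L w.1 (q.rep n) (q'.rep n))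
      (hq.mono fun n hn => by
        obtain ⟨w, hw, h⟩ := Paper.mem_rball_iff.1 hn
        exact ⟨⟨w, hw⟩, h⟩)
    exact Paper.mem_rball_iff.2 ⟨w, hw, wrel_iff.2 hq⟩

theorem conn : Conn L (Lim L U p) := by
  obtain ⟨q, hq⟩ := exists_rep (L := L) (U := U) (f := p) (h := 0) (.of_forall fun n => rfl)
  refine ⟨q, fun q' => ?_⟩
  obtain ⟨h, hh⟩ := q'.rep_bounded
  refine ⟨h, mem_rball_iff.2 ((hq.and hh).mono fun n hn => ?_)⟩
  rw [hn.1]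
  exact hn.2

theorem exists_pointedIso (hX : ∀ n, Equational L (X n)) (q : Lim L U p) (h : ℕ) :
    ∃ n, PointedIso L (rball L q h) q (rball L (q.rep n) h) (q.rep n) := by
  have hfin : Finite (rball L q h) := (finite_rball (equational hX) q h).to_subtype
  have hinj : ∀ᶠ n in U, ∀ y y' : rball L q h, y.1.rep n = y'.1.rep n → y = y' :=
    eventually_all.2 fun y => eventually_all.2 fun y' => by
      by_cases hy : y = y'
      · exact .of_forall fun _ _ => hy
      · refine (Ultrafilter.eventually_not.2 fun hn => hy (Subtype.ext (ext_rep hn))).mono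
          fun n hn h => absurd h hn
  have hrel : ∀ᶠ n in U, ∀ (a : (k : ℕ) × L.Relations k) (x : Fin a.1 → rball L q h),
      Structure.RelMap a.2 (fun i => (x i : Lim L U p)) ↔
        Structure.RelMap a.2 fun i => (x i).1.rep n :=
    eventually_all.2 fun a => eventually_all.2 fun x =>
      Ultrafilter.eventually_iff_of_iff relMap_iff
  have hmem : ∀ᶠ n in U, ∀ y : rball L q h, y.1.rep n ∈ rball L (q.rep n) h :=
    eventually_all.2 fun y => mem_rball_iff.1 y.2
  have hsurj : ∀ᶠ n in U, ∀ v ∈ rball L (q.rep n) h, ∃ y : rball L q h, y.1.rep n = v := by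
    by_contra hc
    have hc := Ultrafilter.eventually_not.2 hc
    have hex : ∀ n, ∃ v : X n, (¬ ∀ v ∈ rball L (q.rep n) h, ∃ y : rball L q h, y.1.rep n = v) →
        v ∈ rball L (q.rep n) h ∧ ∀ y : rball L q h, y.1.rep n ≠ v := fun n => by
      by_cases hn : ∀ v ∈ rball L (q.rep n) h, ∃ y : rball L q h, y.1.rep n = v
      · exact ⟨q.rep n, fun h => absurd hn h⟩
      · push Not at hn
        exact ⟨hn.choose, fun _ => hn.choose_spec⟩
    choose v hv using hex
    have hv := hc.mono fun n hn => hv n hn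
    obtain ⟨y, hy⟩ := exists_rep_of_mem_rball q (hv.mono fun n hn => hn.1)
    have hyq : y ∈ rball L q h := mem_rball_iff.2 ((hv.and hy).mono fun n hn => by
      rw [hn.2]
      exact hn.1.1)
    obtain ⟨n, hn⟩ := (hv.and hy).exists
    exact hn.1.2 ⟨y, hyq⟩ hn.2
  obtain ⟨n, ⟨hinj, hrel⟩, hmem, hsurj⟩ := ((hinj.and hrel).and (hmem.and hsurj)).exists
  refine ⟨n, Equiv.ofBijective (fun y => ⟨y.1.rep n, hmem y⟩) ⟨fun y y' hy => ?_, fun v => ?_⟩,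
    fun k R x => hrel ⟨k, R⟩ x, fun _ => rfl⟩
  · exact hinj y y' (congrArg Subtype.val hy)
  · obtain ⟨y, hy⟩ := hsurj v v.2
    exact ⟨y, Subtype.ext hy⟩

theorem satRule (hX : ∀ n, Equational L (X n)) {Γ : RelRule.{u} L}
    (hΓ : ∀ n, SatRule L (X n) Γ) : SatRule L (Lim L U p) Γ := by
  intro q
  obtain ⟨n, hn⟩ := exists_pointedIso hX q Γ.r
  obtain ⟨i, hi⟩ := hΓ n (q.rep n)
  let := Γ.struc i
  exact ⟨i, hn.trans hi (rball_mono (Nat.zero_le _) rfl)⟩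

end Lim

theorem exists_word_of_not_lAgree {M N : Type*} [L.Structure M] [L.Structure N] {x : M} {y : N}
    (h : ¬ ∀ K, LAgree L K x y) : ∃ (w : List (Letter L)) (x' : M) (y' : N), wrel L w x x' ∧
      wrel L w y y' ∧ ¬ SameTp L x' y' ∧ ∀ K < w.length, LAgree L K x y := by
  classical
  have h := not_forall.1 h
  obtain ⟨K, hK, hmin⟩ : ∃ K, ¬ LAgree L K x y ∧ ∀ m < K, LAgree L m x y :=
    ⟨Nat.find h, Nat.find_spec h, fun m hm => not_not.1 (Nat.find_min h hm)⟩
  unfold LAgree at hK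
  push Not at hK
  obtain ⟨w, hw, x', y', hx, hy, hne⟩ := hK
  exact ⟨w, x', y', hx, hy, hne, fun m hm => hmin m (hm.trans_le hw)⟩

/-- A class of connected structures given by local rules cannot contain infinitely many
pairwise nonisomorphic structures. -/
theorem exists_equiv_of_sequence [L.IsRelational] [Finite ((k : ℕ) × L.Relations k)]
    (Sig : Set (RelRule.{u} L))
    (hclass : ∀ (M : Type u) (_ : L.Structure M), Conn L M → (∀ Γ ∈ Sig, SatRule L M Γ) →
      Periodic L M ∧ Equational L M ∧ Comm L M)
    (hreg : ∀ (M N : Type u) (_ : L.Structure M) (_ : L.Structure N),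
      Conn L M → (∀ Γ ∈ Sig, SatRule L M Γ) → Conn L N → (∀ Γ ∈ Sig, SatRule L N Γ) →
        SRcond L M N)
    (hC : ∀ n, Conn L (X n)) (hS : ∀ n, ∀ Γ ∈ Sig, SatRule L (X n) Γ) :
    ∃ m n, m ≠ n ∧ Nonempty (X m ≃[L] X n) := by
  by_contra! hne
  have hX : ∀ n, Equational L (X n) := fun n => (hclass _ _ (hC n) (hS n)).2.1
  choose p hp using hC
  let U := hyperfilter ℕ
  have hSL : ∀ s : (∀ n, X n), ∀ Γ ∈ Sig, SatRule L (Lim L U s) Γ := fun s Γ hΓ =>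
    Lim.satRule hX fun n => hS n Γ hΓ
  obtain ⟨hPM, hEM, -⟩ := hclass (Lim L U p) _ Lim.conn (hSL p)
  obtain ⟨x, hx⟩ := Lim.exists_rep (L := L) (U := U) (f := p) (h := 0) (.of_forall fun n => rfl)
  have hniso : ∀ᶠ n in U, ¬ Nonempty (Lim L U p ≃[L] X n) := by
    refine Set.Finite.compl_mem_hyperfilter (Set.Subsingleton.finite ?_)
    rintro m ⟨f⟩ n ⟨g⟩
    by_contra hmn
    exact (hne m n hmn).false (g.comp f.symm)
  have hbad : ∀ᶠ n in U, ¬ ∀ K, LAgree L K x (p n) := hniso.mono fun n hn hA => by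
    obtain ⟨f, -⟩ := exists_equiv_of_lAgree hEM (hX n) Lim.conn ⟨p n, hp n⟩
      (hreg _ _ _ _ Lim.conn (hSL p) ⟨p n, hp n⟩ (hS n)) hA
    exact hn ⟨f⟩
  have hex : ∀ n, ∃ (w : List (Letter L)) (q : Lim L U p) (s : X n),
      (¬ ∀ K, LAgree L K x (p n)) → wrel L w x q ∧ wrel L w (p n) s ∧ ¬ SameTp L q s ∧
        ∀ K < w.length, LAgree L K x (p n) := fun n => by
    by_cases hn : ∀ K, LAgree L K x (p n)
    · exact ⟨[], x, p n, fun h => absurd hn h⟩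
    · obtain ⟨w, q, s, h⟩ := exists_word_of_not_lAgree hn
      exact ⟨w, q, s, fun _ => h⟩
  choose w q s hwqs using hex
  obtain ⟨hPN, hEN, hcomm⟩ := hclass (Lim L U s) _ Lim.conn (hSL s)
  obtain ⟨y, hy⟩ := Lim.exists_rep (L := L) (U := U) (f := s) (h := 0) (.of_forall fun n => rfl)
  obtain ⟨K, hK⟩ := exists_forall_lAgree hEM hEN Lim.conn Lim.conn hPM hPN hcomm
    (hreg _ _ _ _ Lim.conn (hSL p) Lim.conn (hSL s))
    (hreg _ _ _ _ Lim.conn (hSL s) Lim.conn (hSL s))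
  obtain ⟨n, ⟨hbad, hxn, hyn⟩, hxA, hyA⟩ := ((hbad.and (hx.and hy)).and
    ((Lim.eventually_lAgree hX x K).and (Lim.eventually_lAgree hX y (2 * K + 1)))).exists
  obtain ⟨hwq, hws, hst, hmin⟩ := hwqs n hbad
  rw [hxn] at hxA
  rw [hyn] at hyA
  have hlen : K < (w n).length := by
    by_contra! hle
    exact hst (hxA _ hle _ _ hwq hws)
  rw [← List.take_append_drop ((w n).length - (K + 1)) (w n)] at hwq hws
  obtain ⟨z, hxz, hzq⟩ := wrel_append.1 hwq
  obtain ⟨z', hpz, hzs⟩ := wrel_append.1 hws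
  set w' := (w n).drop ((w n).length - (K + 1)) with hw'
  have hlen' : w'.length = K + 1 := by
    rw [hw', List.length_drop]
    omega
  have hzz : LAgree L K z z' := (hmin ((w n).length - 1) (by omega)).tail
    (by rw [List.length_take]; omega) hxz hpz
  obtain ⟨z'', hz''⟩ := hyA.symm.exists_wrel (w := winv w') (by rw [length_winv]; omega)
    (wrel_winv hzs)
  have hzz' : LAgree L K z'' z' := hyA.tail (by rw [length_winv]; omega) hz'' (wrel_winv hzs)
  exact hst ((hK z z'' (hzz.trans hzz'.symm) _ w' le_rfl _ _ hzq (wrel_of_winv hz'')).trans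
    hyA.sameTp)

end Limits

/-- **Theorem 3.11.** Let `Σ` be a set of local rules for a finite relational language `L`.
If the connected `L`-structures satisfying `Σ` are periodic, equational and commutative,
and if their class is strongly regular, then this class is a finite union of isomorphism
classes. -/
theorem thm_3_11 [L.IsRelational] (hLfin : Finite ((k : ℕ) × L.Relations k))
    (Sig : Set (RelRule.{u} L))
    (hclass : ∀ (M : Type u) (iM : L.Structure M), @Conn L M iM →
      (∀ Γ ∈ Sig, @SatRule L M iM Γ) →
        @Periodic L M iM ∧ @Equational L M iM ∧ @Comm L M iM)
    (hreg : ∀ (M N : Type u) (iM : L.Structure M) (iN : L.Structure N),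
      @Conn L M iM → (∀ Γ ∈ Sig, @SatRule L M iM Γ) →
      @Conn L N iN → (∀ Γ ∈ Sig, @SatRule L N iN Γ) →
        @SRcond L M N iM iN) :
    ∃ (k : ℕ) (carrier : Fin k → Type u) (struc : ∀ i, L.Structure (carrier i)),
      (∀ i, @Conn L (carrier i) (struc i) ∧ ∀ Γ ∈ Sig, @SatRule L (carrier i) (struc i) Γ) ∧
      ∀ (M : Type u) (iM : L.Structure M), @Conn L M iM →
        (∀ Γ ∈ Sig, @SatRule L M iM Γ) →
          ∃ i, Nonempty (@FirstOrder.Language.Equiv L M (carrier i) iM (struc i)) := by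
  let E := {p : (M : Type u) × L.Structure M //
    @Conn L p.1 p.2 ∧ ∀ Γ ∈ Sig, @SatRule L p.1 p.2 Γ}
  let S : Setoid E :=
    { r := fun p q => Nonempty (@FirstOrder.Language.Equiv L p.1.1 q.1.1 p.1.2 q.1.2)
      iseqv :=
        { refl := fun p => ⟨@FirstOrder.Language.Equiv.refl L p.1.1 p.1.2⟩
          symm := fun {p q} ⟨f⟩ => ⟨@FirstOrder.Language.Equiv.symm L p.1.1 q.1.1 p.1.2 q.1.2 f⟩
          trans := fun {p q r} ⟨f⟩ ⟨g⟩ => ⟨@FirstOrder.Language.Equiv.comp L p.1.1 q.1.1 p.1.2 q.1.2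
            r.1.1 r.1.2 g f⟩ } }
  have hfin : Finite (Quotient S) := by
    by_contra hinf
    have := not_finite_iff_infinite.1 hinf
    let e := Infinite.natEmbedding (Quotient S)
    let : ∀ n, L.Structure (e n).out.1.1 := fun n => (e n).out.1.2
    obtain ⟨m, n, hmn, hiso⟩ := exists_equiv_of_sequence (X := fun n => (e n).out.1.1) Sig hclass
      hreg (fun n => (e n).out.2.1) (fun n => (e n).out.2.2)
    exact hmn (e.injective (Quotient.out_equiv_out.1 hiso))
  obtain ⟨k, ⟨e⟩⟩ := Finite.exists_equiv_fin (Quotient S)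
  refine ⟨k, fun i => (e.symm i).out.1.1, fun i => (e.symm i).out.1.2,
    fun i => (e.symm i).out.2, fun M iM hC hS => ?_⟩
  let a : E := ⟨⟨M, iM⟩, hC, hS⟩
  have ha : S.r a (e.symm (e ⟦a⟧)).out := by
    rw [e.symm_apply_apply]
    exact S.symm (Quotient.mk_out a)
  exact ⟨e ⟦a⟧, ha⟩

end Paper
end

section
/- Under the standing hypotheses on Δ, for each integer k ≥ 1 there are only finitely many isomorphism classes (modulo G) of Δ-patches consisting of exactly k tiles. (Corollary 1.4) -/
open Set Metric

namespace Paper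

variable {E : Type*} [MetricSpace E]

/-- Image of a tile under an isometry (right action of `σ` on tiles). -/
def tmap (σ : E ≃ᵢ E) (T : Set E) : Set E := σ '' T

/-- Image of a set of tiles under an isometry. -/
def smap (σ : E ≃ᵢ E) (ℰ : Set (Set E)) : Set (Set E) := tmap σ '' ℰ

/-- `bt ℰ T n` is the set `B_n^ℰ(T)` of tiles of `ℰ` at combinatorial distance at most `n`
from `T`. -/
def bt (ℰ : Set (Set E)) (T : Set E) : ℕ → Set (Set E)
  | 0 => {T}
  | n + 1 => {U | U ∈ ℰ ∧ ∃ V ∈ bt ℰ T n, (U ∩ V).Nonempty}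

/-- A tile is a closed bounded subset of `E`. -/
def IsTile (T : Set E) : Prop := IsClosed T ∧ Bornology.IsBounded T

variable (G : Subgroup (E ≃ᵢ E))

/-- `(ℰ,T) ≅ (ℰ',T')` modulo `G`. -/
def PIso (ℰ : Set (Set E)) (T : Set E) (ℰ' : Set (Set E)) (T' : Set E) : Prop :=
  ∃ σ ∈ G, smap σ ℰ = ℰ' ∧ tmap σ T = T'

/-- `(ℰ,T) ≤ (ℰ',T')` modulo `G`. -/
def PLe (ℰ : Set (Set E)) (T : Set E) (ℰ' : Set (Set E)) (T' : Set E) : Prop :=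
  ∃ σ ∈ G, smap σ ℰ ⊆ ℰ' ∧ tmap σ T = T'

/-- A `p`-configuration. -/
def IsConfig (p : ℕ) (ℰ : Set (Set E)) (T : Set E) : Prop :=
  ℰ.Finite ∧ T ∈ ℰ ∧ (∀ S ∈ ℰ, IsTile S) ∧ bt ℰ T p = ℰ ∧
    ∀ S ∈ bt ℰ T (p - 1), S ⊆ interior (⋃₀ (bt ℰ S 1))

/-- A `p`-local rule: a finite family of pairwise nonisomorphic `p`-configurations
satisfying the two compatibility conditions. -/
structure LocalRule (E : Type*) [MetricSpace E] (G : Subgroup (E ≃ᵢ E)) where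
  p : ℕ
  hp : 1 ≤ p
  m : ℕ
  C : Fin m → Set (Set E)
  c : Fin m → Set E
  config : ∀ i, IsConfig p (C i) (c i)
  nonIso : ∀ i j, i ≠ j → ¬ PIso G (C i) (c i) (C j) (c j)
  cond1 : ∀ i j, PLe G (bt (C i) (c i) 1) (c i) (bt (C j) (c j) 1) (c j) →
    PIso G (bt (C i) (c i) 1) (c i) (bt (C j) (c j) 1) (c j)
  cond2 : ∀ i, ∀ S ∈ bt (C i) (c i) 1, ∃ j,
    PIso G (bt (C i) S (p - 1)) S (bt (C j) (c j) (p - 1)) (c j)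

/-- A set of tiles satisfies a local rule `Γ` if each `(B_p^ℰ(T),T)` is isomorphic
to one of the configurations of `Γ`. -/
def Satisfies (Γ : LocalRule E G) (ℰ : Set (Set E)) : Prop :=
  ∀ T ∈ ℰ, ∃ i, PIso G (bt ℰ T Γ.p) T (Γ.C i) (Γ.c i)

/-- The pairs `(B_r^ℰ(T),T)`, `T ∈ ℰ`, fall into finitely many isomorphism classes. -/
def FinClasses (ℰ : Set (Set E)) (r : ℕ) : Prop :=
  ∃ 𝒜 : Set (Set E), 𝒜.Finite ∧ 𝒜 ⊆ ℰ ∧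
    ∀ T ∈ ℰ, ∃ S ∈ 𝒜, PIso G (bt ℰ S r) S (bt ℰ T r) T

/-- A tiling of `E`. -/
def IsTiling (𝒯 : Set (Set E)) : Prop :=
  (∀ T ∈ 𝒯, IsTile T) ∧ ⋃₀ 𝒯 = univ ∧
    ∀ r : ℕ, 1 ≤ r →
      (∀ T ∈ 𝒯, (bt 𝒯 T r).Finite ∧ ⋃₀ (bt 𝒯 T (r - 1)) ⊆ interior (⋃₀ (bt 𝒯 T r))) ∧
      (∀ S ∈ 𝒯, ∀ T ∈ 𝒯, PLe G (bt 𝒯 S r) S (bt 𝒯 T r) T →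
        PIso G (bt 𝒯 S r) S (bt 𝒯 T r) T) ∧
      FinClasses G 𝒯 r

/-- Standing hypothesis on the `q`-local rule `Δ`: no nontrivial element of `G` fixes all
the tiles of some `B_{q-1}^{𝒟_i}(D_i)`. -/
def RigidRule (Δ : LocalRule E G) : Prop :=
  ∀ i, ∀ σ ∈ G, (∀ T ∈ bt (Δ.C i) (Δ.c i) (Δ.p - 1), tmap σ T = T) → σ = 1

/-- A patch. -/
def IsPatch (ℰ : Set (Set E)) : Prop :=
  ∀ S ∈ ℰ, ∀ T ∈ ℰ, ∃ r : ℕ, T ∈ bt ℰ S r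

/-- `I_Γ(ℰ)`. -/
def IRule (Γ : LocalRule E G) (ℰ : Set (Set E)) : Set (Set E) :=
  {T | T ∈ ℰ ∧ ∃ i, PIso G (bt ℰ T Γ.p) T (Γ.C i) (Γ.c i)}

/-- A `Γ`-patch. -/
def IsRulePatch (Γ : LocalRule E G) (ℰ : Set (Set E)) : Prop :=
  (∀ T ∈ ℰ, ∃ i, PLe G (bt ℰ T Γ.p) T (Γ.C i) (Γ.c i)) ∧
    ∃ 𝒜 ⊆ IRule G Γ ℰ, IsPatch 𝒜 ∧ ℰ = ⋃ T ∈ 𝒜, bt ℰ T Γ.p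

/-- The local isomorphism property for a tiling. -/
def TilingLIP (𝒯 : Set (Set E)) : Prop :=
  ∀ ℰ ⊆ 𝒯, IsPatch ℰ → ℰ.Finite →
    ∃ k : ℕ, 1 ≤ k ∧ ∀ T ∈ 𝒯, ∃ σ ∈ G, smap σ ℰ ⊆ bt 𝒯 T k

/-- `𝒮 ⋐ 𝒯` for tilings: each finite subpatch of `𝒮` is isomorphic to a subpatch of `𝒯`. -/
def TSub (𝒮 𝒯 : Set (Set E)) : Prop :=
  ∀ ℰ ⊆ 𝒮, IsPatch ℰ → ℰ.Finite →
    ∃ ℱ ⊆ 𝒯, IsPatch ℱ ∧ ∃ σ ∈ G, smap σ ℰ = ℱ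

/-- Locally isomorphic tilings. -/
def TLocIso (𝒮 𝒯 : Set (Set E)) : Prop := TSub G 𝒮 𝒯 ∧ TSub G 𝒯 𝒮

/-- A rigid tiling: no nontrivial element of `G` leaves it globally invariant. -/
def TRigid (𝒯 : Set (Set E)) : Prop := ∀ σ ∈ G, smap σ 𝒯 = 𝒯 → σ = 1

theorem tmap_one (T : Set E) : tmap 1 T = T := Set.image_id T

theorem tmap_mul (σ τ : E ≃ᵢ E) (T : Set E) : tmap (σ * τ) T = tmap σ (tmap τ T) :=
  Set.image_comp σ τ T

theorem smap_one (ℰ : Set (Set E)) : smap 1 ℰ = ℰ := by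
  simp [smap, tmap_one]

theorem smap_mul (σ τ : E ≃ᵢ E) (ℰ : Set (Set E)) : smap (σ * τ) ℰ = smap σ (smap τ ℰ) := by
  simp only [smap, Set.image_image, tmap_mul]

theorem tmap_inv_tmap (σ : E ≃ᵢ E) (T : Set E) : tmap σ⁻¹ (tmap σ T) = T := by
  rw [← tmap_mul, inv_mul_cancel, tmap_one]

theorem smap_inv_smap (σ : E ≃ᵢ E) (ℰ : Set (Set E)) : smap σ⁻¹ (smap σ ℰ) = ℰ := by
  rw [← smap_mul, inv_mul_cancel, smap_one]

theorem tmap_injective (σ : E ≃ᵢ E) : Function.Injective (tmap σ) :=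
  σ.injective.image_injective

theorem tmap_inter_nonempty (σ : E ≃ᵢ E) (S T : Set E) :
    (tmap σ S ∩ tmap σ T).Nonempty ↔ (S ∩ T).Nonempty := by
  rw [tmap, tmap, ← Set.image_inter σ.injective, Set.image_nonempty]

theorem bt_smap (σ : E ≃ᵢ E) (ℰ : Set (Set E)) (T : Set E) (n : ℕ) :
    bt (smap σ ℰ) (tmap σ T) n = smap σ (bt ℰ T n) := by
  induction n with
  | zero => simp [bt, smap]
  | succ n ih =>
    ext U
    constructor
    · rintro ⟨⟨U', hU', rfl⟩, V, hV, hUV⟩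
      rw [ih] at hV
      obtain ⟨V', hV', rfl⟩ := hV
      exact ⟨U', ⟨hU', V', hV', (tmap_inter_nonempty σ U' V').1 hUV⟩, rfl⟩
    · rintro ⟨U', ⟨hU', V', hV', hUV⟩, rfl⟩
      refine ⟨⟨U', hU', rfl⟩, tmap σ V', ?_, (tmap_inter_nonempty σ U' V').2 hUV⟩
      rw [ih]
      exact ⟨V', hV', rfl⟩

theorem bt_mono_left {X : Type*} {ℰ 𝓕 : Set (Set X)} (h : ℰ ⊆ 𝓕) (T : Set X) (n : ℕ) :
    bt ℰ T n ⊆ bt 𝓕 T n := by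
  induction n with
  | zero => exact subset_rfl
  | succ n ih =>
    rintro U ⟨hU, V, hV, hUV⟩
    exact ⟨h hU, V, ih hV, hUV⟩

theorem bt_subset {X : Type*} {ℰ : Set (Set X)} {T : Set X} (hT : T ∈ ℰ) (n : ℕ) :
    bt ℰ T n ⊆ ℰ := by
  cases n with
  | zero => exact Set.singleton_subset_iff.2 hT
  | succ n => exact fun _ h => h.1

theorem bt_succ_of_adj {X : Type*} {ℰ : Set (Set X)} {T V : Set X} (hT : T ∈ ℰ)
    (hTV : (T ∩ V).Nonempty)
    (n : ℕ) : bt ℰ T n ⊆ bt ℰ V (n + 1) := by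
  induction n with
  | zero =>
    rintro _ rfl
    exact ⟨hT, V, rfl, hTV⟩
  | succ n ih =>
    rintro U ⟨hU, W, hW, hUW⟩
    exact ⟨hU, W, ih hW, hUW⟩

theorem bt_monotone {X : Type*} {ℰ : Set (Set X)} (hne : ∀ U ∈ ℰ, U.Nonempty) {T : Set X}
    (hT : T ∈ ℰ) :
    Monotone (bt ℰ T) :=
  monotone_nat_of_le_succ fun n _ hU =>
    have hUℰ := bt_subset hT n hU
    ⟨hUℰ, _, hU, by simpa using hne _ hUℰ⟩

theorem bt_succ_congr {X : Type*} {ℰ : Set (Set X)} {T : Set X} {m n : ℕ}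
    (h : bt ℰ T m = bt ℰ T n) :
    bt ℰ T (m + 1) = bt ℰ T (n + 1) := by
  simp only [bt, h]

/-- In a finite patch of nonempty tiles, the ball of radius the number of tiles is everything. -/
theorem IsPatch.subset_bt {X : Type*} {ℰ : Set (Set X)} (hℰ : IsPatch ℰ)
    (hne : ∀ U ∈ ℰ, U.Nonempty)
    (hfin : ℰ.Finite) {k : ℕ} (hk : ℰ.ncard ≤ k) {T : Set X} (hT : T ∈ ℰ) :
    ℰ ⊆ bt ℰ T k := by
  have hmono := bt_monotone hne hT
  have hbfin (n : ℕ) : (bt ℰ T n).Finite := hfin.subset (bt_subset hT n)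
  have heq {m n : ℕ} (hmn : m ≤ n) (h : (bt ℰ T m).ncard = (bt ℰ T n).ncard) :
      bt ℰ T m = bt ℰ T n :=
    Set.eq_of_subset_of_ncard_le (hmono hmn) h.ge (hbfin n)
  have hstab {n : ℕ} (hn : k ≤ n) : (bt ℰ T n).ncard = (bt ℰ T k).ncard :=
    Nat.stabilises_of_monotone (f := fun n => (bt ℰ T n).ncard)
      (fun m n hmn => Set.ncard_le_ncard (hmono hmn) (hbfin n))
      (fun m => (Set.ncard_le_ncard (bt_subset hT m) hfin).trans hk)
      (fun m hm => congrArg Set.ncard (bt_succ_congr (heq m.le_succ hm))) hn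
  intro U hU
  obtain ⟨r, hr⟩ := hℰ T hT U hU
  rcases le_total r k with hrk | hkr
  · exact hmono hrk hr
  · rwa [heq hkr (hstab hkr).symm]

theorem IsPatch.smap {ℰ : Set (Set E)} (hℰ : IsPatch ℰ) (σ : E ≃ᵢ E) : IsPatch (smap σ ℰ) := by
  rintro _ ⟨S, hS, rfl⟩ _ ⟨T, hT, rfl⟩
  obtain ⟨r, hr⟩ := hℰ S hS T hT
  refine ⟨r, ?_⟩
  rw [bt_smap]
  exact ⟨T, hr, rfl⟩

variable {G}

theorem PLe.smap_left {ℰ ℰ' : Set (Set E)} {T T' : Set E} (h : PLe G ℰ T ℰ' T')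
    {σ : E ≃ᵢ E} (hσ : σ ∈ G) : PLe G (smap σ ℰ) (tmap σ T) ℰ' T' := by
  obtain ⟨τ, hτ, h1, h2⟩ := h
  refine ⟨τ * σ⁻¹, G.mul_mem hτ (G.inv_mem hσ), ?_, ?_⟩
  · rwa [smap_mul, smap_inv_smap]
  · rwa [tmap_mul, tmap_inv_tmap]

theorem PIso.smap_left {ℰ ℰ' : Set (Set E)} {T T' : Set E} (h : PIso G ℰ T ℰ' T')
    {σ : E ≃ᵢ E} (hσ : σ ∈ G) : PIso G (smap σ ℰ) (tmap σ T) ℰ' T' := by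
  obtain ⟨τ, hτ, h1, h2⟩ := h
  refine ⟨τ * σ⁻¹, G.mul_mem hτ (G.inv_mem hσ), ?_, ?_⟩
  · rwa [smap_mul, smap_inv_smap]
  · rwa [tmap_mul, tmap_inv_tmap]

theorem PIso.symm {ℰ ℰ' : Set (Set E)} {T T' : Set E} (h : PIso G ℰ T ℰ' T') :
    PIso G ℰ' T' ℰ T := by
  obtain ⟨σ, hσ, rfl, rfl⟩ := h
  exact ⟨σ⁻¹, G.inv_mem hσ, smap_inv_smap σ ℰ, tmap_inv_tmap σ T⟩

theorem IsRulePatch.smap {Γ : LocalRule E G} {ℰ : Set (Set E)} (h : IsRulePatch G Γ ℰ)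
    {σ : E ≃ᵢ E} (hσ : σ ∈ G) : IsRulePatch G Γ (smap σ ℰ) := by
  obtain ⟨h1, 𝒜, h𝒜, hpatch, hunion⟩ := h
  refine ⟨?_, Paper.smap σ 𝒜, ?_, hpatch.smap σ, ?_⟩
  · rintro _ ⟨T, hT, rfl⟩
    obtain ⟨i, hi⟩ := h1 T hT
    refine ⟨i, ?_⟩
    rw [bt_smap]
    exact hi.smap_left hσ
  · rintro _ ⟨T, hT, rfl⟩
    obtain ⟨hTℰ, i, hi⟩ := h𝒜 hT
    refine ⟨⟨T, hTℰ, rfl⟩, i, ?_⟩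
    rw [bt_smap]
    exact hi.smap_left hσ
  · have h2 : (⋃ T ∈ Paper.smap σ 𝒜, bt (Paper.smap σ ℰ) T Γ.p)
        = ⋃ T ∈ 𝒜, Paper.smap σ (bt ℰ T Γ.p) := by
      rw [show Paper.smap σ 𝒜 = tmap σ '' 𝒜 from rfl, Set.biUnion_image]
      simp only [bt_smap]
    rw [h2]
    conv_lhs => rw [hunion]
    simp only [Paper.smap, Set.image_iUnion]

theorem IsRulePatch.nonempty_of_mem {Γ : LocalRule E G} {ℰ : Set (Set E)}
    (h : IsRulePatch G Γ ℰ) {U : Set E} (hU : U ∈ ℰ) : U.Nonempty := by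
  obtain ⟨-, 𝒜, -, -, hunion⟩ := h
  rw [hunion] at hU
  obtain ⟨T, -, hU⟩ := Set.mem_iUnion₂.1 hU
  obtain ⟨p, hp⟩ : ∃ p, Γ.p = p + 1 := ⟨Γ.p - 1, (Nat.sub_add_cancel Γ.hp).symm⟩
  rw [hp] at hU
  obtain ⟨-, V, -, hUV⟩ := hU
  exact hUV.left

/-- The placements of the `i`-th configuration whose ball of radius `p - 1` lies in `𝓗`. -/
def placements (Γ : LocalRule E G) (𝓗 : Set (Set E)) (i : Fin Γ.m) : Set (E ≃ᵢ E) :=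
  {σ | σ ∈ G ∧ smap σ (bt (Γ.C i) (Γ.c i) (Γ.p - 1)) ⊆ 𝓗}

/-- Tiles obtained from those of the configurations by `n` successive gluings. -/
def reach (Γ : LocalRule E G) : ℕ → Set (Set E)
  | 0 => ⋃ i, Γ.C i
  | n + 1 => ⋃ i, ⋃ σ ∈ placements Γ (reach Γ n) i, smap σ (Γ.C i)

theorem RigidRule.finite_placements {Γ : LocalRule E G} (hΓ : RigidRule G Γ)
    {𝓗 : Set (Set E)} (h𝓗 : 𝓗.Finite) (i : Fin Γ.m) : (placements Γ 𝓗 i).Finite := by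
  set 𝓑 := bt (Γ.C i) (Γ.c i) (Γ.p - 1) with h𝓑
  have : Finite 𝓗 := h𝓗
  have : Finite 𝓑 := (Γ.config i).1.subset (bt_subset (Γ.config i).2.1 _)
  let f : placements Γ 𝓗 i → 𝓑 → 𝓗 := fun σ T => ⟨tmap σ.1 T.1, σ.2.2 ⟨T.1, T.2, rfl⟩⟩
  have hf : Function.Injective f := by
    rintro ⟨σ, hσ⟩ ⟨τ, hτ⟩ h
    refine Subtype.ext (inv_mul_eq_one.1 (hΓ i (σ⁻¹ * τ) (G.mul_mem (G.inv_mem hσ.1) hτ.1) ?_))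
    intro T hT
    have hTeq : tmap σ T = tmap τ T := congrArg Subtype.val (congrFun h ⟨T, hT⟩)
    rw [tmap_mul, ← hTeq, tmap_inv_tmap]
  exact Finite.of_injective f hf

theorem RigidRule.finite_reach {Γ : LocalRule E G} (hΓ : RigidRule G Γ) (n : ℕ) :
    (reach Γ n).Finite := by
  induction n with
  | zero => exact Set.finite_iUnion fun i => (Γ.config i).1
  | succ n ih =>
    exact Set.finite_iUnion fun i => (hΓ.finite_placements ih i).biUnion fun σ _ =>
      (Γ.config i).1.image _

theorem smap_bt_subset_reach {Γ : LocalRule E G} {ℰ 𝒜 : Set (Set E)} (h𝒜 : 𝒜 ⊆ IRule G Γ ℰ)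
    {T₀ : Set E} {σ : E ≃ᵢ E} (hσ : σ ∈ G) (h0 : smap σ (bt ℰ T₀ Γ.p) ⊆ reach Γ 0) (n : ℕ) :
    ∀ T ∈ bt 𝒜 T₀ n, smap σ (bt ℰ T Γ.p) ⊆ reach Γ n := by
  induction n with
  | zero =>
    rintro _ rfl
    exact h0
  | succ n ih =>
    rintro T ⟨hT, V, hV, hTV⟩
    obtain ⟨hTℰ, i, hi⟩ := h𝒜 hT
    obtain ⟨τ, hτ, h1, h2⟩ := (hi.smap_left hσ).symm
    have hsub : smap τ (bt (Γ.C i) (Γ.c i) (Γ.p - 1)) ⊆ reach Γ n := by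
      rw [← bt_smap, h1, h2, bt_smap]
      refine (Set.image_mono ?_).trans (ih V hV)
      refine (bt_mono_left (bt_subset hTℰ Γ.p) T (Γ.p - 1)).trans ?_
      refine (bt_succ_of_adj hTℰ hTV (Γ.p - 1)).trans ?_
      rw [Nat.sub_add_cancel Γ.hp]
    rw [← h1]
    intro U hU
    exact Set.mem_iUnion.2 ⟨i, Set.mem_iUnion₂.2 ⟨τ, ⟨hτ, hsub⟩, hU⟩⟩

/-- A finite nonempty `Γ`-patch can be moved into the tiles reachable in `k` gluings, where `k`
bounds its number of tiles. -/
theorem IsRulePatch.exists_smap_subset_reach {Γ : LocalRule E G} {ℰ : Set (Set E)}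
    (h : IsRulePatch G Γ ℰ) (hfin : ℰ.Finite) (hne : ℰ.Nonempty) {k : ℕ} (hk : ℰ.ncard ≤ k) :
    ∃ σ ∈ G, Paper.smap σ ℰ ⊆ reach Γ k := by
  have hnonempty : ∀ U ∈ ℰ, U.Nonempty := fun U hU => h.nonempty_of_mem hU
  obtain ⟨-, 𝒜, h𝒜, hpatch, hunion⟩ := h
  have h𝒜ℰ : 𝒜 ⊆ ℰ := fun T hT => (h𝒜 hT).1
  obtain ⟨U₀, hU₀⟩ := hne
  rw [hunion] at hU₀
  obtain ⟨T₀, hT₀, -⟩ := Set.mem_iUnion₂.1 hU₀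
  obtain ⟨-, i, σ, hσ, h1, -⟩ := h𝒜 hT₀
  have h0 : Paper.smap σ (bt ℰ T₀ Γ.p) ⊆ reach Γ 0 := h1 ▸ Set.subset_iUnion Γ.C i
  have hball := hpatch.subset_bt (fun U hU => hnonempty U (h𝒜ℰ hU)) (hfin.subset h𝒜ℰ)
    ((Set.ncard_le_ncard h𝒜ℰ hfin).trans hk) hT₀
  refine ⟨σ, hσ, ?_⟩
  rintro _ ⟨U, hU, rfl⟩
  rw [hunion] at hU
  obtain ⟨T, hT, hUT⟩ := Set.mem_iUnion₂.1 hU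
  exact smap_bt_subset_reach h𝒜 hσ h0 k T (hball hT) ⟨U, hUT, rfl⟩

variable (G)

/-- **Corollary 1.4.** For each integer `k ≥ 1` there are only finitely many isomorphism
classes (modulo `G`) of `Δ`-patches consisting of exactly `k` tiles. -/
theorem cor_1_4 {E : Type*} [MetricSpace E] [ConnectedSpace E]
    (hcomp : ∀ (x : E) (η : ℝ), IsCompact (Metric.closedBall x η))
    (G : Subgroup (E ≃ᵢ E)) (Δ : LocalRule E G) (hΔ : RigidRule G Δ)
    (k : ℕ) (hk : 1 ≤ k) :
    ∃ 𝒜 : Set (Set (Set E)), 𝒜.Finite ∧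
      (∀ 𝓕 ∈ 𝒜, IsRulePatch G Δ 𝓕 ∧ 𝓕.Finite ∧ 𝓕.ncard = k) ∧
      ∀ ℰ : Set (Set E), IsRulePatch G Δ ℰ → ℰ.Finite → ℰ.ncard = k →
        ∃ 𝓕 ∈ 𝒜, ∃ σ ∈ G, smap σ ℰ = 𝓕 := by
  refine ⟨{𝓕 | 𝓕 ⊆ reach Δ k ∧ IsRulePatch G Δ 𝓕 ∧ 𝓕.Finite ∧ 𝓕.ncard = k}, ?_, ?_, ?_⟩
  · exact (hΔ.finite_reach k).finite_subsets.subset fun 𝓕 h𝓕 => h𝓕.1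
  · exact fun 𝓕 h𝓕 => h𝓕.2
  · intro ℰ hℰ hfin hcard
    have hne : ℰ.Nonempty := Set.nonempty_of_ncard_ne_zero (by omega)
    obtain ⟨σ, hσ, hsub⟩ := hℰ.exists_smap_subset_reach hfin hne hcard.le
    refine ⟨smap σ ℰ, ⟨hsub, hℰ.smap hσ, hfin.image _, ?_⟩, σ, hσ, rfl⟩
    rw [smap, Set.ncard_image_of_injective ℰ (tmap_injective σ), hcard]

end Paper
end

section
/- Let 𝓛 be a finite relational language, θ(u,v) an 𝓛-formula with two free variables, and M,N elementarily equivalent 𝓛-structures with M connected and locally finite. Suppose there exists x ∈ M such that {y ∈ M : M ⊨ θ(x,y)} is finite, and there exists an automorphism g of N such that N ⊨ θ(y,yg) for every y ∈ N. Then there exists an automorphism f of M such that M ⊨ θ(y,yf) for every y ∈ M. Moreover, for each r ∈ ℕ, if {y ∈ N : yg = y} contains no ball B_N(z,r), then f can be chosen so that {y ∈ M : yf = y} contains no ball B_M(z,r). (Proposition 3.1) -/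
open FirstOrder FirstOrder.Language Set

namespace Paper

universe u v

variable (L : FirstOrder.Language)

section Transfer

variable {L}

open Filter

/-- A structure embeds elementarily into an ultrapower of any elementarily equivalent structure. -/
theorem exists_elementaryEmbedding_ultrapower.{a, b, c, d} {L : FirstOrder.Language.{a, b}}
    {M : Type c} {N : Type d} [L.Structure M] [L.Structure N] [Nonempty N] (h : M ≅[L] N) :
    ∃ (I : Type (max a b c)) (U : Ultrafilter I),
      Nonempty (M ↪ₑ[L] (U : Filter I).Product fun _ : I => N) := by
  classical
  let D := {φ : L.Formula M // φ.Realize id}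
  have key (F : Finset D) : ∃ v : M → N, ∀ φ ∈ F, φ.1.Realize v := by
    have hM : (Formula.iInf fun φ : F => φ.1.1).exClosure.Realize M := by
      rw [Formula.realize_exClosure]
      refine ⟨fun a => a, (BoundedFormula.realize_restrictFreeVar
        (f := id) (v := fun a => a.1) id fun _ => rfl).2 ?_⟩
      exact Formula.realize_iInf.2 fun φ => φ.1.2
    have hN := (elementarilyEquivalent_iff.1 h _).1 hM
    rw [← Formula.exists_realize_equivSentence_iff_realize_exClosure] at hN
    obtain ⟨v, hv⟩ := hN
    have hv' := (Formula.realize_equivSentence_symm N (Formula.equivSentence _) v).2 hv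
    rw [Equiv.symm_apply_apply, Formula.realize_iInf] at hv'
    exact ⟨v, fun φ hφ => hv' ⟨φ, hφ⟩⟩
  choose v hv using key
  let U : Ultrafilter (Finset D) := Ultrafilter.of atTop
  let j : M → (U : Filter (Finset D)).Product fun _ => N :=
    fun m => ((fun F => v F m : ∀ _ : Finset D, N) : (U : Filter (Finset D)).Product fun _ => N)
  have hj (φ : L.Formula M) (hφ : φ.Realize id) : φ.Realize j := by
    refine (Ultraproduct.realize_formula_cast φ fun m F => v F m).2 ?_
    refine Filter.Eventually.filter_mono (Ultrafilter.of_le atTop) ?_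
    filter_upwards [eventually_ge_atTop {(⟨φ, hφ⟩ : D)}] with F hF
    exact hv F _ (hF (Finset.mem_singleton_self _))
  refine ⟨Finset D, U, ⟨⟨j, fun n φ x => ?_⟩⟩⟩
  have hpos (ψ : L.Formula (Fin n)) (hψ : ψ.Realize x) : ψ.Realize (j ∘ x) :=
    Formula.realize_relabel.1 (hj (ψ.relabel x) (Formula.realize_relabel.2 hψ))
  refine ⟨fun hx => ?_, hpos φ⟩
  by_contra hn
  exact Formula.realize_not.1 (hpos φ.not (Formula.realize_not.2 hn)) hx

/-- An elementary embedding creates no new solutions of a formula with finitely many solutions. -/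
theorem exists_eq_comp_of_finite_setOf_realize {M P ι : Type*} [L.Structure M] [L.Structure P]
    [Finite ι] (j : M ↪ₑ[L] P) (φ : L.Formula (M ⊕ ι))
    (hfin : {t : ι → M | φ.Realize (Sum.elim id t)}.Finite) (s : ι → P)
    (hs : φ.Realize (Sum.elim j s)) : ∃ t : ι → M, s = j ∘ t := by
  have := hfin.to_subtype
  let S := {t : ι → M | φ.Realize (Sum.elim id t)}
  let χ : L.Formula M := Formula.iAlls ι (φ.imp (Formula.iSup fun t : S =>
    Formula.iInf fun i : ι => Term.equal (Term.var (Sum.inr i)) (Term.var (Sum.inl (t.1 i)))))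
  have hM : χ.Realize id := by
    simp only [χ, Formula.realize_iAlls, Formula.realize_imp, Formula.realize_iSup,
      Formula.realize_iInf, Formula.realize_equal]
    exact fun t ht => ⟨⟨t, ht⟩, fun i => rfl⟩
  have hP := (j.map_formula χ id).2 hM
  simp only [χ, Formula.realize_iAlls, Formula.realize_imp, Formula.realize_iSup,
    Formula.realize_iInf, Formula.realize_equal] at hP
  obtain ⟨t, ht⟩ := hP s hs
  exact ⟨t.1, funext ht⟩

theorem relMap_ultraproduct_cast {N I : Type*} [L.Structure N] {U : Ultrafilter I} {k : ℕ}
    (R : L.Relations k) (b : Fin k → I → N) :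
    (Structure.RelMap R fun c => (b c : (U : Filter I).Product fun _ : I => N)) ↔
      ∀ᶠ i in U, Structure.RelMap R fun c => b c i := by
  apply relMap_quotient_mk'

/-- The automorphism of an ultrapower acting as a given automorphism in each coordinate. -/
def ultrapowerEquiv {N I : Type*} [L.Structure N] (U : Ultrafilter I) (g : N ≃[L] N) :
    ((U : Filter I).Product fun _ : I => N) ≃[L] ((U : Filter I).Product fun _ : I => N) where
  toFun := Quotient.map' (fun b i => g (b i)) fun _ _ h => h.mono fun _ hi => congrArg g hi
  invFun := Quotient.map' (fun b i => g.symm (b i))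
    fun _ _ h => h.mono fun _ hi => congrArg g.symm hi
  left_inv p := by
    induction p using Quotient.inductionOn'
    simp only [Quotient.map'_mk'', g.symm_apply_apply]
    rfl
  right_inv p := by
    induction p using Quotient.inductionOn'
    simp only [Quotient.map'_mk'', g.apply_symm_apply]
    rfl
  map_fun' F p := by
    choose b hb using fun i => Quotient.exists_rep (p i)
    obtain rfl := funext hb
    refine (congrArg _ (Ultraproduct.funMap_cast F b)).trans ?_
    refine Eq.trans ?_ (Ultraproduct.funMap_cast F fun c i => g (b c i)).symm
    exact congrArg Quotient.mk'' (funext fun i => g.map_fun F fun c => b c i)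
  map_rel' R p := by
    choose b hb using fun i => Quotient.exists_rep (p i)
    obtain rfl := funext hb
    refine (relMap_ultraproduct_cast R fun c i => g (b c i)).trans
      (Iff.trans ?_ (relMap_ultraproduct_cast R b).symm)
    exact eventually_congr (Eventually.of_forall fun i => g.map_rel R fun c => b c i)

theorem mem_rball_one_of_relMap {M : Type*} [L.Structure M] {k : ℕ} {R : L.Relations k}
    {t : Fin k → M} (ht : Structure.RelMap R t) (i j : Fin k) : t j ∈ rball L (t i) 1 :=
  Or.inr ⟨k, R, t, ht, ⟨i, rfl⟩, j, rfl⟩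

/-- Membership in a ball passes to ultrapowers. -/
theorem mem_rball_ultrapower {N I : Type*} [L.Structure N] [Finite ((k : ℕ) × L.Relations k)]
    (U : Ultrafilter I) (a : I → N) (h : ℕ) (b : I → N) (hb : ∀ᶠ i in U, b i ∈ rball L (a i) h) :
    (b : (U : Filter I).Product fun _ : I => N) ∈
      rball L (a : (U : Filter I).Product fun _ : I => N) h := by
  induction h generalizing b with
  | zero => exact Quotient.sound' hb
  | succ h ih =>
    rcases Ultrafilter.eventually_or.1 hb with hb | hb
    · exact Or.inl (ih b hb)
    · have hb' : ∀ᶠ i in U, ∃ q : Σ R : (k : ℕ) × L.Relations k, Fin R.1 × Fin R.1,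
          ∃ t : Fin q.1.1 → N, Structure.RelMap q.1.2 t ∧ t q.2.1 ∈ rball L (a i) h ∧
            t q.2.2 = b i := by
        filter_upwards [hb] with i hi
        obtain ⟨k, R, t, ht, ⟨m, hm⟩, l, hl⟩ := hi
        exact ⟨⟨⟨k, R⟩, m, l⟩, t, ht, hm, hl⟩
      rw [Ultrafilter.eventually_exists_iff] at hb'
      obtain ⟨⟨⟨k, R⟩, m, l⟩, hq⟩ := hb'
      have hN : ∀ i, ∃ t : Fin k → N, (∃ t : Fin k → N, Structure.RelMap R t ∧
          t m ∈ rball L (a i) h ∧ t l = b i) →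
          Structure.RelMap R t ∧ t m ∈ rball L (a i) h ∧ t l = b i := by
        intro i
        by_cases ht : ∃ t : Fin k → N, Structure.RelMap R t ∧ t m ∈ rball L (a i) h ∧ t l = b i
        · exact ht.imp fun t ht _ => ht
        · exact ⟨fun _ => a i, fun h => absurd h ht⟩
      choose t ht using hN
      have hq' := hq.mono fun i => ht i
      refine Or.inr ⟨k, R, fun c => ((fun i => t i c : I → N) : (U : Filter I).Product _),
        ?_, ⟨m, ih _ (hq'.mono fun i hi => hi.2.1)⟩, l,
        Quotient.sound' (hq'.mono fun i hi => hi.2.2)⟩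
      exact (relMap_ultraproduct_cast R fun c i => t i c).2 (hq'.mono fun i hi => hi.1)

/-- In a connected structure, a property passed along relations holds everywhere
once it holds somewhere. -/
theorem Conn.forall_of_exists {M : Type*} [L.Structure M] (hM : Conn L M) {P : M → Prop}
    (hP : ∀ (k : ℕ) (R : L.Relations k) (t : Fin k → M), Structure.RelMap R t →
      ∀ i j, P (t i) → P (t j)) {a : M} (ha : P a) (b : M) : P b := by
  obtain ⟨u, hu⟩ := hM
  have key (h : ℕ) : ∀ v ∈ rball L u h, (P v ↔ P u) := by
    induction h with
    | zero => rintro v rfl; rfl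
    | succ h ih =>
      rintro v (hv | ⟨k, R, t, ht, ⟨i, hi⟩, j, rfl⟩)
      · exact ih v hv
      · rw [← ih _ hi]
        exact ⟨hP k R t ht j i, hP k R t ht i j⟩
  obtain ⟨h, hh⟩ := hu a
  obtain ⟨h', hh'⟩ := hu b
  exact (key h' b hh').2 ((key h a hh).1 ha)

/-- A related tuple of an elementary extension of a locally finite structure which meets that
structure lies in it. -/
theorem LocFin.exists_eq_comp {M P : Type*} [L.Structure M] [L.Structure P] (hM : LocFin L M)
    (j : M ↪ₑ[L] P) {k : ℕ} {R : L.Relations k} {s : Fin k → P} (hs : Structure.RelMap R s)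
    {i : Fin k} (hi : s i ∈ range j) : ∃ t : Fin k → M, s = j ∘ t := by
  obtain ⟨u, hu⟩ := hi
  refine exists_eq_comp_of_finite_setOf_realize j
    (R.formula (fun l => Term.var (Sum.inr l)) ⊓
      Term.equal (Term.var (Sum.inr i)) (Term.var (Sum.inl u))) ?_ s ?_
  · refine (Set.Finite.pi' fun _ : Fin k => hM u).subset fun t ht l => ?_
    simp only [mem_ofPred_eq, Formula.realize_inf, Formula.realize_rel, Formula.realize_equal,
      Term.realize_var, Sum.elim_inr, Sum.elim_inl, id] at ht
    exact ht.2 ▸ mem_rball_one_of_relMap ht.1 i l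
  · simp only [Formula.realize_inf, Formula.realize_rel, Formula.realize_equal,
      Term.realize_var, Sum.elim_inr, Sum.elim_inl]
    exact ⟨hs, hu.symm⟩

/-- Passing to an elementary extension does not enlarge the balls of a locally finite structure. -/
theorem LocFin.rball_subset_image {M P : Type*} [L.Structure M] [L.Structure P] (hM : LocFin L M)
    (j : M ↪ₑ[L] P) (z : M) (h : ℕ) : rball L (j z) h ⊆ j '' rball L z h := by
  induction h with
  | zero => rintro _ rfl; exact ⟨z, rfl, rfl⟩
  | succ h ih =>
    rintro w (hw | ⟨k, R, s, hs, ⟨i, hi⟩, l, rfl⟩)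
    · exact (image_mono fun _ => Or.inl) (ih hw)
    · obtain ⟨u, hu, hui⟩ := ih hi
      obtain ⟨t, rfl⟩ := hM.exists_eq_comp j hs ⟨u, hui⟩
      obtain rfl : u = t i := j.injective hui
      exact ⟨t l, Or.inr ⟨k, R, t, (j.map_rel R t).1 hs, ⟨i, hu⟩, l, rfl⟩, rfl⟩

/-- An automorphism of an elementary extension of a connected locally finite structure which
maps some element of that structure into it restricts to an automorphism. -/
theorem exists_restrict_equiv {M P : Type*} [L.Structure M] [L.Structure P] [L.IsRelational]
    (hconn : Conn L M) (hM : LocFin L M) (j : M ↪ₑ[L] P) (g : P ≃[L] P) {x : M}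
    (hx : g (j x) ∈ range j) : ∃ f : M ≃[L] M, ∀ m, j (f m) = g (j m) := by
  have hmaps (e : P ≃[L] P) {a : M} (ha : e (j a) ∈ range j) (m : M) : e (j m) ∈ range j := by
    refine hconn.forall_of_exists (P := fun m => e (j m) ∈ range j) ?_ ha m
    intro k R t ht i l hi
    have hs : Structure.RelMap R (e ∘ j ∘ t) := (e.map_rel R _).2 ((j.map_rel R t).2 ht)
    obtain ⟨t', ht'⟩ := hM.exists_eq_comp j hs hi
    exact ⟨t' l, (congrFun ht' l).symm⟩
  choose f hf using hmaps g hx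
  have hx' : g.symm (j (f x)) ∈ range j := ⟨x, by rw [hf, g.symm_apply_apply]⟩
  choose f' hf' using hmaps g.symm hx'
  refine ⟨⟨⟨f, f', fun m => j.injective ?_, fun m => j.injective ?_⟩, fun F => isEmptyElim F,
    fun R t => ?_⟩, hf⟩
  · rw [hf', hf, g.symm_apply_apply]
  · rw [hf, hf', g.apply_symm_apply]
  · change Structure.RelMap R (f ∘ t) ↔ _
    rw [← j.map_rel R t, ← j.map_rel R (f ∘ t), ← g.map_rel R (j ∘ t)]
    exact iff_of_eq (congrArg _ (funext fun i => hf (t i)))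

end Transfer

/-- **Proposition 3.1.** Let `θ(u,v)` be a formula and `M, N` elementarily equivalent
`L`-structures with `M` connected locally finite. If some `x ∈ M` has
`{y : θ(x,y)}` finite and `N` has an automorphism `g` with `θ(y,yg)` for all `y`, then `M`
has an automorphism `f` with `θ(y,yf)` for all `y`; moreover if the fixed points of `g`
contain no ball `B_N(z,r)` then `f` may be chosen so that its fixed points contain no ball
`B_M(z,r)`. -/
theorem prop_3_1 [L.IsRelational] (hLfin : Finite ((k : ℕ) × L.Relations k))
    (M : Type u) (N : Type v) [L.Structure M] [L.Structure N]
    (θ : L.Formula (Fin 2)) (heq : M ≅[L] N)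
    (hMconn : Conn L M) (hMlf : LocFin L M)
    (x : M) (hx : {y : M | θ.Realize ![x, y]}.Finite)
    (g : N ≃[L] N) (hg : ∀ y : N, θ.Realize ![y, g y]) :
    (∃ f : M ≃[L] M, ∀ y : M, θ.Realize ![y, f y]) ∧
      ∀ r : ℕ, (∀ z : N, ¬ rball L z r ⊆ {y : N | g y = y}) →
        ∃ f : M ≃[L] M, (∀ y : M, θ.Realize ![y, f y]) ∧
          ∀ z : M, ¬ rball L z r ⊆ {y : M | f y = y} := by
  have : Nonempty N := heq.nonempty_iff.1 ⟨x⟩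
  obtain ⟨I, U, ⟨j⟩⟩ := exists_elementaryEmbedding_ultrapower heq
  have hθ (p : (U : Filter I).Product fun _ : I => N) :
      θ.Realize ![p, ultrapowerEquiv U g p] := by
    induction p using Quotient.inductionOn' with | _ b
    have := (Ultraproduct.realize_formula_cast (u := U) θ
      ![b, fun i => g (b i)]).2 (Filter.Eventually.of_forall fun i => by
        convert! hg (b i) using 1
        ext l; fin_cases l <;> rfl)
    convert! this using 1
    ext l; fin_cases l <;> rfl
  have hgx : ultrapowerEquiv U g (j x) ∈ range j := by
    obtain ⟨t, ht⟩ := exists_eq_comp_of_finite_setOf_realize (ι := Fin 1) j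
      (θ.relabel ![Sum.inl x, Sum.inr 0]) (by
        refine (hx.preimage (f := fun t : Fin 1 → M => t 0) fun s _ t _ hst => ?_).subset
          fun t ht => ?_
        · ext l; rw [Subsingleton.elim l 0]; exact hst
        · rw [mem_ofPred_eq, Formula.realize_relabel] at ht
          change θ.Realize ![x, t 0]
          convert! ht using 1
          ext l; fin_cases l <;> rfl) (fun _ => ultrapowerEquiv U g (j x)) (by
        rw [Formula.realize_relabel]
        convert! hθ (j x) using 1
        ext l; fin_cases l <;> rfl)
    exact ⟨t 0, (congrFun ht 0).symm⟩
  obtain ⟨f, hf⟩ := exists_restrict_equiv hMconn hMlf j _ hgx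
  have hfθ (y : M) : θ.Realize ![y, f y] := by
    rw [← j.map_formula]
    convert! hθ (j y) using 1
    ext l; fin_cases l
    · rfl
    · exact hf y
  refine ⟨⟨f, hfθ⟩, fun r hr => ⟨f, hfθ, fun z hz => ?_⟩⟩
  obtain ⟨a, ha⟩ := Quotient.exists_rep (j z)
  choose b hb hgb using fun i => not_subset.1 (hr (a i))
  have ha' : (a : (U : Filter I).Product fun _ : I => N) = j z := ha
  have hmem := mem_rball_ultrapower U a r b (Filter.Eventually.of_forall hb)
  rw [ha'] at hmem
  obtain ⟨m, hm, hmb⟩ := hMlf.rball_subset_image j z r hmem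
  have hfix : ultrapowerEquiv U g (j m) = j m := by rw [← hf, hz hm]
  rw [hmb] at hfix
  obtain ⟨i, hi⟩ := (show ∀ᶠ i in (U : Filter I), g (b i) = b i from
    Quotient.exact' hfix).exists
  exact hgb i hi

end Paper
end

section
/- Let 𝓛 be a finite relational language and let M,N be locally isomorphic, locally finite, connected 𝓛-structures. If N is periodic, then M is isomorphic to N. (Proposition 3.5) -/
open FirstOrder FirstOrder.Language Set

namespace Paper

universe u v

variable (L : FirstOrder.Language)

section Helpers

open Filter

variable {L} {M : Type*} {N : Type*} [L.Structure M] [L.Structure N]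

theorem self_mem_rball (u : M) (h : ℕ) : u ∈ rball L u h := by
  induction h with
  | zero => rfl
  | succ h ih => exact Or.inl ih

theorem rball_mono_s17 (u : M) : Monotone (rball L u) :=
  monotone_nat_of_le_succ fun _ => subset_union_left

theorem relMap_mem_rball_succ {u : M} {h k : ℕ} {R : L.Relations k} {t : Fin k → M}
    (ht : Structure.RelMap R t) {i : Fin k} (hi : t i ∈ rball L u h) (j : Fin k) :
    t j ∈ rball L u (h + 1) :=
  Or.inr ⟨k, R, t, ht, ⟨i, hi⟩, j, rfl⟩

theorem relMap_mem_rball_one {k : ℕ} {R : L.Relations k} {t : Fin k → M}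
    (ht : Structure.RelMap R t) (i j : Fin k) : t j ∈ rball L (t i) 1 :=
  relMap_mem_rball_succ ht (self_mem_rball _ 0) j

theorem LocFin.rball_finite (hM : LocFin L M) (u : M) (h : ℕ) : (rball L u h).Finite := by
  induction h with
  | zero => exact finite_singleton u
  | succ h ih =>
    refine (ih.union (ih.biUnion fun x _ => hM x)).subset ?_
    rintro v (hv | ⟨k, R, t, ht, ⟨i, hi⟩, j, rfl⟩)
    · exact Or.inl hv
    · exact Or.inr (mem_biUnion hi (relMap_mem_rball_one ht i j))

theorem rball_trans {u v w : M} {m n : ℕ} (hv : v ∈ rball L u m) (hw : w ∈ rball L v n) :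
    w ∈ rball L u (m + n) := by
  induction n generalizing w with
  | zero => rwa [mem_singleton_iff.1 hw]
  | succ n ih =>
    obtain hw | ⟨k, R, t, ht, ⟨i, hi⟩, j, rfl⟩ := hw
    · exact Or.inl (ih hw)
    · exact relMap_mem_rball_succ ht (ih hi) j

theorem rball_symm {u v : M} {h : ℕ} (hv : v ∈ rball L u h) : u ∈ rball L v h := by
  induction h generalizing v with
  | zero => exact (mem_singleton_iff.1 hv).symm
  | succ h ih =>
    obtain hv | ⟨k, R, t, ht, ⟨i, hi⟩, j, rfl⟩ := hv
    · exact Or.inl (ih hv)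
    · rw [add_comm]
      exact rball_trans (relMap_mem_rball_one ht j i) (ih hi)

theorem Conn.exists_mem_rball (hM : Conn L M) (u v : M) : ∃ h, v ∈ rball L u h := by
  obtain ⟨w, hw⟩ := hM
  obtain ⟨m, hm⟩ := hw u
  obtain ⟨n, hn⟩ := hw v
  exact ⟨m + n, rball_trans (rball_symm hm) hn⟩

/-- The map `φ` preserves relations between elements of `s`. -/
def HomOn (L : FirstOrder.Language) {M N : Type*} [L.Structure M] [L.Structure N]
    (φ : M → N) (s : Set M) : Prop :=
  ∀ (k : ℕ) (R : L.Relations k) (t : Fin k → M), (∀ i, t i ∈ s) →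
    Structure.RelMap R t → Structure.RelMap R fun i => φ (t i)

theorem HomOn.mem_rball {φ : M → N} {u : M} {h : ℕ} (hφ : HomOn L φ (rball L u h)) {j : ℕ}
    (hj : j ≤ h) {x : M} (hx : x ∈ rball L u j) : φ x ∈ rball L (φ u) j := by
  induction j generalizing x with
  | zero => rw [mem_singleton_iff.1 hx]; exact self_mem_rball _ 0
  | succ j ih =>
    obtain hx | ⟨k, R, t, ht, ⟨i, hi⟩, l, rfl⟩ := hx
    · exact Or.inl (ih (by omega) hx)
    · exact relMap_mem_rball_succ
        (hφ k R t (fun l => rball_mono_s17 u hj (relMap_mem_rball_succ ht hi l)) ht)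
        (ih (by omega) hi) l

/-- Total maps `φ`, `ψ` restricting to mutually inverse isomorphisms between the balls of radius
`h` around `u` and `φ u`. -/
structure BallIso (L : FirstOrder.Language) {M N : Type*} [L.Structure M] [L.Structure N]
    (φ : M → N) (ψ : N → M) (u : M) (h : ℕ) : Prop where
  homOn : HomOn L φ (rball L u h)
  homOn_symm : HomOn L ψ (rball L (φ u) h)
  leftInvOn : LeftInvOn ψ φ (rball L u h)
  rightInvOn : RightInvOn ψ φ (rball L (φ u) h)

namespace BallIso

variable {φ : M → N} {ψ : N → M} {u : M} {h : ℕ}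

theorem mem_rball_symm (H : BallIso L φ ψ u h) {j : ℕ} (hj : j ≤ h) {y : N}
    (hy : y ∈ rball L (φ u) j) : ψ y ∈ rball L u j := by
  have := H.homOn_symm.mem_rball hj hy
  rwa [H.leftInvOn (self_mem_rball u h)] at this

theorem relMap_iff (H : BallIso L φ ψ u h) {k : ℕ} (R : L.Relations k) {t : Fin k → M}
    (ht : ∀ i, t i ∈ rball L u h) :
    Structure.RelMap R (fun i => φ (t i)) ↔ Structure.RelMap R t := by
  refine ⟨fun hR => ?_, H.homOn k R t ht⟩
  have := H.homOn_symm k R _ (fun i => H.homOn.mem_rball le_rfl (ht i)) hR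
  simpa only [fun i => H.leftInvOn (ht i)] using this

end BallIso

theorem PointedIso.exists_ballIso {w : N} {u : M} {h : ℕ}
    (H : PointedIso L (rball L w h) w (rball L u h) u) (σ : N ≃[L] N) :
    ∃ (φ : M → N) (ψ : N → M), φ u = σ w ∧ BallIso L φ ψ u h := by
  classical
  obtain ⟨f, hf, hfw⟩ := H
  have hσ (g : N ≃[L] N) (s : Set N) : HomOn L g s := fun k R t _ ht => (g.map_rel R t).2 ht
  let φ : M → N := fun x => if hx : x ∈ rball L u h then σ (f.symm ⟨x, hx⟩) else σ w
  let ψ : N → M := fun y => if hy : σ.symm y ∈ rball L w h then f ⟨σ.symm y, hy⟩ else u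
  have hφ (x : rball L u h) : φ x = σ (f.symm x) := dif_pos x.2
  have hψ (y : rball L w h) : ψ (σ y) = f y := by simp [ψ]
  have hu : φ u = σ w := by
    have : f ⟨w, self_mem_rball w h⟩ = ⟨u, self_mem_rball u h⟩ := Subtype.ext (hfw _)
    rw [hφ ⟨u, self_mem_rball u h⟩, ← this, f.symm_apply_apply]
  have hball {y : N} (hy : y ∈ rball L (φ u) h) : ∃ z : rball L w h, σ z = y := by
    have := (hσ σ.symm (rball L (σ w) h)).mem_rball le_rfl (hu ▸ hy)
    rw [σ.symm_apply_apply] at this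
    exact ⟨⟨_, this⟩, σ.apply_symm_apply y⟩
  refine ⟨φ, ψ, hu, ?_, ?_, ?_, ?_⟩
  · intro k R t ht hR
    lift t to Fin k → rball L u h using ht
    simp only [hφ]
    refine (σ.map_rel R fun i => (f.symm (t i) : N)).2 ((hf k R fun i => f.symm (t i)).2 ?_)
    simpa using hR
  · intro k R t ht hR
    choose z hz using fun i => hball (ht i)
    obtain rfl : (fun i => σ (z i)) = t := funext hz
    simp only [hψ]
    exact (hf k R z).1 ((σ.map_rel R fun i => (z i : N)).1 hR)
  · intro x hx
    rw [hφ ⟨x, hx⟩, hψ, f.apply_symm_apply]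
  · intro y hy
    obtain ⟨z, rfl⟩ := hball hy
    rw [hψ, hφ, f.symm_apply_apply]

theorem RelSub.exists_pointedIso (H : RelSub L M N) (u : M) (h : ℕ) :
    ∃ w : N, PointedIso L (rball L w h) w (rball L u h) u := by
  obtain ⟨g, -⟩ | ⟨-, hinf⟩ := H u h
  · exact ⟨_, (g ⟨u, Equiv.refl _, fun _ _ _ => Iff.rfl, fun _ => rfl⟩).2⟩
  · exact hinf.nonempty

theorem Ultrafilter.exists_eventually_eq_of_finite {ι α : Type*} (U : Ultrafilter ι) {s : Set α}
    (hs : s.Finite) {f : ι → α} (hf : ∀ᶠ i in U, f i ∈ s) : ∃ a ∈ s, ∀ᶠ i in U, f i = a := by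
  have : ∀ᶠ i in U, ∃ a ∈ s, f i = a := hf.mono fun i hi => ⟨f i, hi, rfl⟩
  simpa using (Ultrafilter.eventually_exists_mem_iff hs).1 this

theorem nonempty_equiv_of_ballIso [L.IsRelational] (hM : LocFin L M) (hN : LocFin L N) {u : M}
    (hMu : ∀ x, ∃ h, x ∈ rball L u h) (hNconn : Conn L N) {A : Set N} (hA : A.Finite)
    (H : ∀ h, ∃ (φ : M → N) (ψ : N → M), φ u ∈ A ∧ BallIso L φ ψ u h) :
    Nonempty (M ≃[L] N) := by
  choose φ ψ hφA hφ using H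
  let U : Ultrafilter ℕ := hyperfilter ℕ
  have hge (j : ℕ) : ∀ᶠ h in U, j ≤ h :=
    (Nat.hyperfilter_le_atTop : (U : Filter ℕ) ≤ atTop) (eventually_ge_atTop j)
  have hmem (x : M) : ∀ᶠ h in U, x ∈ rball L u h := by
    obtain ⟨j, hj⟩ := hMu x
    exact (hge j).mono fun h hh => rball_mono_s17 u hh hj
  have hlim (x : M) : ∃ y, ∀ᶠ h in U, φ h x = y := by
    obtain ⟨j, hj⟩ := hMu x
    obtain ⟨y, -, hy⟩ := Ultrafilter.exists_eventually_eq_of_finite U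
      (hA.biUnion fun a _ => hN.rball_finite a j)
      ((hge j).mono fun h hh => mem_biUnion (hφA h) ((hφ h).homOn.mem_rball hh hj))
    exact ⟨y, hy⟩
  choose F hF using hlim
  have hinj : Function.Injective F := by
    intro x y hxy
    obtain ⟨h, hx, hy, hx', hy'⟩ :=
      ((hF x).and ((hF y).and ((hmem x).and (hmem y)))).exists
    exact (hφ h).leftInvOn.injOn hx' hy' (by rw [hx, hy, hxy])
  have hsurj : Function.Surjective F := by
    intro y
    obtain ⟨j, hj⟩ := hNconn.exists_mem_rball (F u) y
    have hy : ∀ᶠ h in U, j ≤ h ∧ y ∈ rball L (φ h u) j :=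
      ((hge j).and (hF u)).mono fun h hh => ⟨hh.1, hh.2 ▸ hj⟩
    obtain ⟨x, -, hx⟩ := Ultrafilter.exists_eventually_eq_of_finite U (hM.rball_finite u j)
      (hy.mono fun h hh => (hφ h).mem_rball_symm hh.1 hh.2)
    obtain ⟨h, ⟨hjh, hyh⟩, hxh, hFh⟩ := (hy.and (hx.and (hF x))).exists
    exact ⟨x, by rw [← hFh, ← hxh, (hφ h).rightInvOn (rball_mono_s17 _ hjh hyh)]⟩
  refine ⟨⟨Equiv.ofBijective F ⟨hinj, hsurj⟩, fun f => isEmptyElim f, fun {k} R t => ?_⟩⟩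
  obtain ⟨h, hFt, ht⟩ :=
    ((eventually_all.2 fun i => hF (t i)).and (eventually_all.2 fun i => hmem (t i))).exists
  change Structure.RelMap R (fun i => F (t i)) ↔ _
  simp only [← hFt]
  exact (hφ h).relMap_iff R ht

end Helpers

/-- **Proposition 3.5.** Let `M, N` be locally isomorphic locally finite connected
`L`-structures. If `N` is periodic then `M` is isomorphic to `N`. -/
theorem prop_3_5 [L.IsRelational] (hLfin : Finite ((k : ℕ) × L.Relations k))
    (M : Type u) (N : Type v) [L.Structure M] [L.Structure N]
    (hloc : RelLocIso L M N) (hMlf : LocFin L M) (hNlf : LocFin L N)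
    (hMconn : Conn L M) (hNconn : Conn L N)
    (hNper : Periodic L N) :
    Nonempty (M ≃[L] N) := by
  obtain ⟨u, hu⟩ := hMconn
  obtain ⟨A, hA, hAN⟩ := hNper
  refine nonempty_equiv_of_ballIso hMlf hNlf hu hNconn hA fun h => ?_
  obtain ⟨w, hw⟩ := hloc.1.exists_pointedIso u h
  obtain ⟨σ, a, ha, rfl⟩ := hAN w
  obtain ⟨φ, ψ, hφ, H⟩ := hw.exists_ballIso σ.symm
  refine ⟨φ, ψ, ?_, H⟩
  rwa [hφ, σ.symm_apply_apply]

end Paper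
end

section
/- Let 𝓛 be a finite relational language and let M be a connected 𝓛-structure such that no nontrivial automorphism of M has a fixed point. Then M has a weakly connected period. (Proposition 3.6) -/
open FirstOrder FirstOrder.Language Set

namespace Paper

universe u v

variable (L : FirstOrder.Language)

/-- A set meeting every orbit of `Aut(M)` in at most one point. -/
def OrbitSeparated {M : Type*} [L.Structure M] (A : Set M) : Prop :=
  ∀ a ∈ A, ∀ b ∈ A, ∀ σ : M ≃[L] M, σ a = b → a = b

theorem weaklyConnected_singleton {M : Type*} [L.Structure M] (u : M) :
    WeaklyConnected L ({u} : Set M) := fun _ hBA hB hne =>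
  absurd ((subset_singleton_iff_eq.1 hBA).resolve_left hB.ne_empty) hne

variable {L}

theorem WeaklyConnected.sUnion {M : Type*} [L.Structure M] {c : Set (Set M)}
    (hc : IsChain (· ⊆ ·) c) (h : ∀ A ∈ c, WeaklyConnected L A) :
    WeaklyConnected L (⋃₀ c) := by
  intro B hBA ⟨x, hx⟩ hne
  obtain ⟨y, hy, hyB⟩ := exists_of_ssubset (hBA.ssubset_of_ne hne)
  obtain ⟨C, hC, hxC⟩ := hBA hx
  obtain ⟨D, hD, hyD⟩ := hy
  obtain ⟨E, hE, hxE, hyE⟩ : ∃ E ∈ c, x ∈ E ∧ y ∈ E := by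
    rcases hc.total hC hD with hCD | hDC
    · exact ⟨D, hD, hCD hxC, hyD⟩
    · exact ⟨C, hC, hxC, hDC hyD⟩
  obtain ⟨k, R, t, hk, ht, ⟨i, hi⟩, j, hj⟩ := h E hE (B ∩ E) inter_subset_right ⟨x, hx, hxE⟩
    fun he => hyB (he.symm ▸ hyE : y ∈ B ∩ E).1
  exact ⟨k, R, t, hk, ht, ⟨i, hi.1⟩, j, ⟨E, hE, hj.1⟩, fun hB => hj.2 ⟨hB, hj.1⟩⟩

theorem OrbitSeparated.sUnion {M : Type*} [L.Structure M] {c : Set (Set M)}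
    (hc : IsChain (· ⊆ ·) c) (h : ∀ A ∈ c, OrbitSeparated L A) :
    OrbitSeparated L (⋃₀ c) := by
  rintro a ⟨C, hC, haC⟩ b ⟨D, hD, hbD⟩ σ hσ
  rcases hc.total hC hD with hCD | hDC
  · exact h D hD a (hCD haC) b hbD σ hσ
  · exact h C hC a haC b (hDC hbD) σ hσ

theorem WeaklyConnected.insert {M : Type*} [L.Structure M] {A : Set M}
    (hA : WeaklyConnected L A) {k : ℕ} {R : L.Relations k} {t : Fin k → M}
    (ht : Structure.RelMap R t) {i j : Fin k} (hi : t i ∈ A) (hj : t j ∉ A) :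
    WeaklyConnected L (insert (t j) A) := by
  have hij : i ≠ j := fun h => hj (h ▸ hi)
  have hk : 2 ≤ k := by
    have := Fin.val_ne_of_ne hij
    omega
  intro B hB hBne hBA
  by_cases hiB : t i ∈ B
  · by_cases hjB : t j ∈ B
    · obtain ⟨k, R, s, hk, hs, ⟨p, hp⟩, q, hq⟩ := hA (B ∩ A) inter_subset_right ⟨t i, hiB, hi⟩
        fun he => hBA (hB.antisymm (insert_subset hjB (inter_eq_right.1 he)))
      exact ⟨k, R, s, hk, hs, ⟨p, hp.1⟩, q, .inr hq.1, fun h => hq.2 ⟨h, hq.1⟩⟩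
    · exact ⟨k, R, t, hk, ht, ⟨i, hiB⟩, j, mem_insert _ _, hjB⟩
  · by_cases hjB : t j ∈ B
    · exact ⟨k, R, t, hk, ht, ⟨j, hjB⟩, i, .inr hi, hiB⟩
    · have hBsub : B ⊆ A := fun x hx => (hB hx).resolve_left fun h => hjB (h ▸ hx)
      obtain ⟨k, R, s, hk, hs, hp, q, hq⟩ := hA B hBsub hBne fun he => hiB (he ▸ hi)
      exact ⟨k, R, s, hk, hs, hp, q, .inr hq.1, hq.2⟩

theorem OrbitSeparated.insert {M : Type*} [L.Structure M] {A : Set M}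
    (hA : OrbitSeparated L A) {v : M} (hv : ∀ σ : M ≃[L] M, ∀ a ∈ A, σ a ≠ v) :
    OrbitSeparated L (insert v A) := by
  rintro a (rfl | ha) b (rfl | hb) σ hσ
  · rfl
  · exact absurd (by rw [← hσ, σ.symm_apply_apply]) (hv σ.symm b hb)
  · exact absurd hσ (hv σ a ha)
  · exact hA a ha b hb σ hσ

/-- A set containing the centre of the balls and closed under relations contains all balls. -/
theorem rball_subset {M : Type*} [L.Structure M] {u : M} {U : Set M} (hu : u ∈ U)
    (hU : ∀ (k : ℕ) (R : L.Relations k) (t : Fin k → M), Structure.RelMap R t →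
      ∀ i j, t i ∈ U → t j ∈ U) (h : ℕ) : rball L u h ⊆ U := by
  induction h with
  | zero => exact singleton_subset_iff.2 hu
  | succ h ih =>
    rintro v (hv | ⟨k, R, t, ht, ⟨i, hi⟩, j, rfl⟩)
    · exact ih hv
    · exact hU k R t ht i j (ih hi)

theorem OrbitSeparated.isPeriod {M : Type*} [L.Structure M] {A : Set M}
    (hA : OrbitSeparated L A) (hcover : ∀ x : M, ∃ σ : M ≃[L] M, ∃ a ∈ A, σ a = x)
    (hfree : ∀ f : M ≃[L] M, (∃ x : M, f x = x) → ∀ x : M, f x = x) :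
    IsPeriod L A := by
  intro x
  obtain ⟨σ, a, ha, hσ⟩ := hcover x
  refine ⟨σ, ⟨a, ha, hσ⟩, ?_⟩
  rintro τ ⟨b, hb, hτ : τ b = x⟩
  have hba : (σ.symm.comp τ) b = a := by
    rw [FirstOrder.Language.Equiv.comp_apply, hτ, ← hσ, σ.symm_apply_apply]
  have hfix := hfree (σ.symm.comp τ) ⟨b, hba.trans (hA b hb a ha _ hba).symm⟩
  ext y
  have := hfix y
  rw [FirstOrder.Language.Equiv.comp_apply] at this
  rw [← σ.apply_symm_apply (τ y), this]

variable (L)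

/-- **Proposition 3.6.** Any connected `L`-structure whose nontrivial automorphisms have no
fixed point has a weakly connected period. -/
theorem prop_3_6 [L.IsRelational] (hLfin : Finite ((k : ℕ) × L.Relations k))
    (M : Type u) [L.Structure M] (hMconn : Conn L M)
    (hfree : ∀ f : M ≃[L] M, (∃ x : M, f x = x) → ∀ x : M, f x = x) :
    ∃ A : Set M, IsPeriod L A ∧ WeaklyConnected L A := by
  obtain ⟨u, hu⟩ := hMconn
  obtain ⟨A, huA, hmax⟩ := zorn_subset_nonempty
    {A : Set M | OrbitSeparated L A ∧ WeaklyConnected L A}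
    (fun c hcS hc _ => ⟨⋃₀ c, ⟨.sUnion hc fun A hA => (hcS hA).1,
      .sUnion hc fun A hA => (hcS hA).2⟩, fun _ => subset_sUnion_of_mem⟩)
    {u} ⟨fun _ ha _ hb _ _ => ha.trans hb.symm, weaklyConnected_singleton L u⟩
  obtain ⟨hsep, hconn⟩ := hmax.prop
  refine ⟨A, hsep.isPeriod (fun x => ?_) hfree, hconn⟩
  obtain ⟨h, hx⟩ := hu x
  refine rball_subset (U := {x | ∃ σ : M ≃[L] M, ∃ a ∈ A, σ a = x})
    ⟨.refl L M, u, singleton_subset_iff.1 huA, rfl⟩ ?_ h hx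
  rintro k R t ht i j ⟨σ, a, ha, hσ⟩
  by_contra hj
  have hi : (σ.symm ∘ t) i ∈ A := by
    rwa [Function.comp_apply, ← hσ, σ.symm_apply_apply]
  have hv : ∀ τ : M ≃[L] M, ∀ b ∈ A, τ b ≠ (σ.symm ∘ t) j := fun τ b hb hτ =>
    hj ⟨σ.comp τ, b, hb, by
      rw [FirstOrder.Language.Equiv.comp_apply, hτ, Function.comp_apply, σ.apply_symm_apply]⟩
  have hjA : (σ.symm ∘ t) j ∉ A := fun h => hv (.refl L M) _ h rfl
  exact hjA (hmax.le_of_ge ⟨hsep.insert hv, hconn.insert ((σ.symm.map_rel R t).2 ht) hi hjA⟩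
    (subset_insert _ _) (mem_insert _ _))

end Paper
end
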